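/- arXiv:2009.02272 — 3 statements merged into one kernel-verified Lean document; each statement's English description precedes it below -/
import Mathlib

section
/- For every natural number n and every k ∈ {0,1,…,n+1}, the polynomial p^B_{n,k}(x) is real-rooted, i.e., all of its complex roots are real. -/
open Polynomial PowerSeries

/-- The polynomials `p^B_{n,k}` defined recursively as in
Proposition (e): `p^B_{0,0} = 1`, `p^B_{0,1} = x`,
`p^B_{n+1,0} = ∑_{i=0}^{n+1} p^B_{n,i}`,
`p^B_{n+1,k} = 2x ∑_{i=0}^{k-1} p^B_{n,i} + 2 ∑_{i=k}^{n+1} p^B_{n,i}` for `1 ≤ k ≤ n+1`, and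
`p^B_{n+1,n+2} = x ∑_{i=0}^{n+1} p^B_{n,i}`. -/
noncomputable def pB : ℕ → ℕ → Polynomial ℝ
  | 0, 0 => 1
  | 0, 1 => Polynomial.X
  | 0, _ + 2 => 0
  | n + 1, 0 => ∑ i ∈ Finset.range (n + 2), pB n i
  | n + 1, k + 1 =>
      if k + 1 ≤ n + 1 then
        2 * Polynomial.X * (∑ i ∈ Finset.range (k + 1), pB n i) +
          2 * ∑ i ∈ Finset.Icc (k + 1) (n + 1), pB n i
      else if k + 1 = n + 2 then
        Polynomial.X * ∑ i ∈ Finset.range (n + 2), pB n i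
      else 0
  termination_by n _ => n

/-- A real polynomial is *real-rooted* if all of its complex roots are real. -/
def RealRooted (p : Polynomial ℝ) : Prop :=
  ∀ z : ℂ, Polynomial.aeval z p = 0 → z.im = 0

/-- The oriented area `Im (conj u * v)` of the parallelogram spanned by `u` and `v`. -/
def orientedArea (u v : ℂ) : ℝ := u.re * v.im - u.im * v.re

lemma orientedArea_sum_nonneg {s t : Finset ℕ} {f g : ℕ → ℂ}
    (h : ∀ i ∈ s, ∀ j ∈ t, 0 ≤ orientedArea (f i) (g j)) :
    0 ≤ orientedArea (∑ i ∈ s, f i) (∑ j ∈ t, g j) := by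
  have key : orientedArea (∑ i ∈ s, f i) (∑ j ∈ t, g j) =
      ∑ i ∈ s, ∑ j ∈ t, orientedArea (f i) (g j) := by
    simp only [orientedArea, Complex.re_sum, Complex.im_sum, Finset.sum_mul_sum,
      Finset.sum_sub_distrib]
  rw [key]
  exact Finset.sum_nonneg fun i hi => Finset.sum_nonneg fun j hj => h i hi j hj

/-- The nonzero numbers `w 0, …, w (N - 1), z * w 0` occur in counterclockwise order. -/
structure ArgOrdered (z : ℂ) (N : ℕ) (w : ℕ → ℂ) : Prop where
  ne_zero : ∀ i < N, w i ≠ 0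
  area_nonneg : ∀ i j, i ≤ j → j < N → 0 ≤ orientedArea (w i) (w j)
  area_mul_nonneg : ∀ i j, i ≤ j → j < N → 0 ≤ orientedArea (w j) (z * w i)

/-- The Eulerian-type transform of a sequence of length `N`. -/
noncomputable def eulerianTransform (z : ℂ) (N : ℕ) (w : ℕ → ℂ) (k : ℕ) : ℂ :=
  z * ∑ i ∈ Finset.range k, w i + ∑ i ∈ Finset.Ico k N, w i

lemma ArgOrdered.smul {z : ℂ} {N : ℕ} {v w : ℕ → ℂ} (h : ArgOrdered z N w) {c : ℕ → ℝ}
    (hc : ∀ i, 0 < c i) (hv : ∀ i < N, v i = c i * w i) : ArgOrdered z N v where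
  ne_zero i hi := by
    rw [hv i hi]
    exact mul_ne_zero (by exact_mod_cast (hc i).ne') (h.ne_zero i hi)
  area_nonneg i j hij hj := by
    rw [hv i (hij.trans_lt hj), hv j hj]
    have h₁ := mul_nonneg (mul_pos (hc i) (hc j)).le (h.area_nonneg i j hij hj)
    simp only [orientedArea, Complex.re_ofReal_mul, Complex.im_ofReal_mul] at h₁ ⊢
    linarith
  area_mul_nonneg i j hij hj := by
    rw [hv i (hij.trans_lt hj), hv j hj]
    have h₁ := mul_nonneg (mul_pos (hc i) (hc j)).le (h.area_mul_nonneg i j hij hj)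
    simp only [orientedArea, Complex.mul_re, Complex.mul_im,
      Complex.ofReal_re, Complex.ofReal_im] at h₁ ⊢
    linarith

/-- The transform at `i ≤ j` in terms of the sums over `[0, i)`, `[i, j)` and `[j, N)`. -/
lemma eulerianTransform_split (z : ℂ) {N i j : ℕ} (w : ℕ → ℂ) (hij : i ≤ j) (hj : j ≤ N) :
    eulerianTransform z N w i = z * ∑ l ∈ Finset.range i, w l +
        ∑ l ∈ Finset.Ico i j, w l + ∑ l ∈ Finset.Ico j N, w l ∧
      eulerianTransform z N w j = z * ∑ l ∈ Finset.range i, w l +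
        z * ∑ l ∈ Finset.Ico i j, w l + ∑ l ∈ Finset.Ico j N, w l := by
  unfold eulerianTransform
  rw [← Finset.sum_Ico_consecutive w hij hj, ← Finset.sum_range_add_sum_Ico w hij]
  constructor <;> ring

/-- The sums over `[0, i)`, `[i, j)` and `[j, N)` inherit the counterclockwise order. -/
lemma ArgOrdered.block_sums {z : ℂ} {N i j : ℕ} {w : ℕ → ℂ} (h : ArgOrdered z N w)
    (hj : j ≤ N) :
    0 ≤ orientedArea (∑ l ∈ Finset.range i, w l) (∑ l ∈ Finset.Ico i j, w l) ∧
    0 ≤ orientedArea (∑ l ∈ Finset.Ico i j, w l) (∑ l ∈ Finset.Ico j N, w l) ∧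
    0 ≤ orientedArea (∑ l ∈ Finset.Ico i j, w l) (z * ∑ l ∈ Finset.range i, w l) ∧
    0 ≤ orientedArea (∑ l ∈ Finset.Ico j N, w l) (z * ∑ l ∈ Finset.Ico i j, w l) := by
  simp only [Finset.mul_sum]
  refine ⟨?_, ?_, ?_, ?_⟩ <;> refine orientedArea_sum_nonneg fun p hp q hq => ?_ <;>
    simp only [Finset.mem_range, Finset.mem_Ico] at hp hq
  · exact h.area_nonneg p q (by omega) (by omega)
  · exact h.area_nonneg p q (by omega) (by omega)
  · exact h.area_mul_nonneg q p (by omega) (by omega)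
  · exact h.area_mul_nonneg q p (by omega) (by omega)

lemma orientedArea_mul_self_nonneg {z : ℂ} (hz : 0 < z.im) (u : ℂ) :
    0 ≤ orientedArea u (z * u) := by
  have : orientedArea u (z * u) = z.im * (u.re ^ 2 + u.im ^ 2) := by
    simp only [orientedArea, Complex.mul_re, Complex.mul_im]
    ring
  rw [this]
  positivity

lemma orientedArea_mul_self_pos {z : ℂ} (hz : 0 < z.im) {u : ℂ} (hu : u ≠ 0) :
    0 < orientedArea u (z * u) := by
  have : orientedArea u (z * u) = z.im * Complex.normSq u := by
    simp only [orientedArea, Complex.mul_re, Complex.mul_im, Complex.normSq_apply]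
    ring
  rw [this]
  exact mul_pos hz (Complex.normSq_pos.2 hu)

lemma orientedArea_transform_eq (z a b c : ℂ) :
    orientedArea (z * a + b + c) (z * a + z * b + c) =
      Complex.normSq z * orientedArea a b + orientedArea b (z * a) + orientedArea b (z * b) +
        orientedArea b c + orientedArea c (z * b) := by
  simp only [orientedArea, Complex.mul_re, Complex.mul_im, Complex.normSq_apply, Complex.add_re,
    Complex.add_im]
  ring

lemma orientedArea_transform_mul_eq (z a b c : ℂ) :
    orientedArea (z * a + z * b + c) (z * (z * a + b + c)) =
      orientedArea (z * a + c) (z * (z * a + c)) +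
        Complex.normSq z * (orientedArea a b + orientedArea b (z * a) + orientedArea b c) +
        orientedArea c (z * b) := by
  simp only [orientedArea, Complex.mul_re, Complex.mul_im, Complex.normSq_apply, Complex.add_re,
    Complex.add_im]
  ring

lemma ArgOrdered.eulerianTransform_ne_zero {z : ℂ} {N : ℕ} {w : ℕ → ℂ} (hz : 0 < z.im)
    (h : ArgOrdered z N w) {i : ℕ} (hi : i < N) : eulerianTransform z N w i ≠ 0 := by
  intro h0
  obtain ⟨h₁, h₂⟩ := eulerianTransform_split z w i.le_succ hi
  obtain ⟨hab, hbc, hba, hcb⟩ := h.block_sums (i := i) hi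
  have key := orientedArea_transform_eq z (∑ l ∈ Finset.range i, w l)
    (∑ l ∈ Finset.Ico i (i + 1), w l) (∑ l ∈ Finset.Ico (i + 1) N, w l)
  have hb : ∑ l ∈ Finset.Ico i (i + 1), w l ≠ 0 := by simpa using h.ne_zero i hi
  have hpos := orientedArea_mul_self_pos hz hb
  have hmul := mul_nonneg (Complex.normSq_nonneg z) hab
  rw [← h₁, h0] at key
  simp only [orientedArea, Complex.zero_re, Complex.zero_im, zero_mul, sub_zero] at *
  linarith

lemma ArgOrdered.eulerianTransform {z : ℂ} {N : ℕ} {w : ℕ → ℂ} (hz : 0 < z.im) (hN : 0 < N)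
    (h : ArgOrdered z N w) : ArgOrdered z (N + 1) (eulerianTransform z N w) where
  ne_zero i hi := by
    rcases (Nat.lt_succ_iff.1 hi).lt_or_eq with hi | rfl
    · exact h.eulerianTransform_ne_zero hz hi
    · have h0 := h.eulerianTransform_ne_zero hz hN
      have hz0 : z ≠ 0 := by
        rintro rfl
        simp at hz
      simp only [_root_.eulerianTransform, Finset.range_zero, Finset.sum_empty, mul_zero, zero_add,
        Nat.Ico_zero_eq_range, Finset.Ico_self, add_zero] at h0 ⊢
      exact mul_ne_zero hz0 h0
  area_nonneg i j hij hj := by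
    obtain ⟨h₁, h₂⟩ := eulerianTransform_split z w hij (Nat.lt_succ_iff.1 hj)
    obtain ⟨hab, hbc, hba, hcb⟩ := h.block_sums (Nat.lt_succ_iff.1 hj)
    rw [h₁, h₂, orientedArea_transform_eq]
    have := orientedArea_mul_self_nonneg hz (∑ l ∈ Finset.Ico i j, w l)
    have := Complex.normSq_nonneg z
    positivity
  area_mul_nonneg i j hij hj := by
    obtain ⟨h₁, h₂⟩ := eulerianTransform_split z w hij (Nat.lt_succ_iff.1 hj)
    obtain ⟨hab, hbc, hba, hcb⟩ := h.block_sums (Nat.lt_succ_iff.1 hj)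
    rw [h₁, h₂, orientedArea_transform_mul_eq]
    have := orientedArea_mul_self_nonneg hz
      (z * ∑ l ∈ Finset.range i, w l + ∑ l ∈ Finset.Ico j N, w l)
    have := Complex.normSq_nonneg z
    positivity

lemma aeval_pB_succ (z : ℂ) (n k : ℕ) (hk : k < n + 3) :
    aeval z (pB (n + 1) k) = ((if k = 0 ∨ k = n + 2 then 1 else 2 : ℝ) : ℂ) *
      eulerianTransform z (n + 2) (fun i => aeval z (pB n i)) k := by
  rcases k with _ | k
  · simp [pB, eulerianTransform]
  · rw [pB]
    by_cases h₁ : k + 1 ≤ n + 1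
    · have h₂ : ¬ (k + 1 = 0 ∨ k + 1 = n + 2) := by omega
      have h₃ : Finset.Icc (k + 1) (n + 1) = Finset.Ico (k + 1) (n + 2) := by
        ext
        simp only [Finset.mem_Icc, Finset.mem_Ico]
        omega
      rw [if_pos h₁, if_neg h₂, h₃]
      simp only [eulerianTransform, map_add, map_mul, map_sum, aeval_X, map_ofNat,
        Complex.ofReal_ofNat]
      ring
    · obtain rfl : k = n + 1 := by omega
      simp [eulerianTransform]

lemma argOrdered_pB {z : ℂ} (hz : 0 < z.im) (n : ℕ) :
    ArgOrdered z (n + 2) fun k => aeval z (pB n k) := by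
  induction n with
  | zero =>
    have hz0 : z ≠ 0 := by
      rintro rfl
      simp at hz
    refine ⟨fun i hi => ?_, fun i j hij hj => ?_, fun i j hij hj => ?_⟩
    · interval_cases i <;> simp [pB, hz0]
    · interval_cases j <;> interval_cases i <;> simp [pB, orientedArea, hz.le, mul_comm]
    · rcases hij.eq_or_lt with rfl | hij
      · exact orientedArea_mul_self_nonneg hz _
      · obtain rfl : i = 0 := by omega
        obtain rfl : j = 1 := by omega
        simp [pB, orientedArea, mul_comm]
  | succ n ih =>
    refine (ih.eulerianTransform hz (by omega)).smul
      (c := fun k => if k = 0 ∨ k = n + 2 then 1 else 2) (fun i => ?_)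
      (fun i hi => aeval_pB_succ z n i hi)
    split_ifs <;> norm_num

/-- Every polynomial `p^B_{n,k}`, `0 ≤ k ≤ n+1`, is real-rooted: all of its complex roots
are real. -/
theorem pB_realRooted (n k : ℕ) (hk : k ≤ n + 1) : RealRooted (pB n k) := by
  have upper : ∀ z : ℂ, 0 < z.im → aeval z (pB n k) ≠ 0 := fun z hz =>
    (argOrdered_pB hz n).ne_zero k (by omega)
  intro z hz
  rcases lt_trichotomy z.im 0 with h | h | h
  · refine absurd ?_ (upper (starRingEnd ℂ z) (by simpa using h))
    rw [aeval_conj, hz, map_zero]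
  · exact h
  · exact absurd hz (upper z h)
end

section
/- For every natural number n, the sequence (p^B_{n,0}(x), p^B_{n,1}(x), …, p^B_{n,n+1}(x)) is an interlacing sequence of real-rooted polynomials: for all 0 ≤ i < j ≤ n+1, the polynomial p^B_{n,i}(x) interlaces p^B_{n,j}(x). -/
open Polynomial PowerSeries

/-- The list of real roots of `p` (with multiplicity), in decreasing order. -/
noncomputable def rootsDesc (p : Polynomial ℝ) : List ℝ :=
  (p.roots.sort (· ≤ ·)).reverse

/-- `Interlaces p q` means: `p` and `q` are nonzero real-rooted polynomials (all complex
roots are real, i.e. each has as many real roots, with multiplicity, as its degree), all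
their roots are nonpositive, and listing the roots `α₁ ≥ α₂ ≥ ⋯` of `p` and
`β₁ ≥ β₂ ≥ ⋯` of `q` with multiplicity in decreasing order, they alternate as
`⋯ ≤ β₃ ≤ α₂ ≤ β₂ ≤ α₁ ≤ β₁ ≤ 0` (in particular `deg p ≤ deg q ≤ deg p + 1`). -/
def Interlaces (p q : Polynomial ℝ) : Prop :=
  p ≠ 0 ∧ q ≠ 0 ∧
  p.roots.card = p.natDegree ∧ q.roots.card = q.natDegree ∧
  p.natDegree ≤ q.natDegree ∧ q.natDegree ≤ p.natDegree + 1 ∧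
  (∀ x ∈ p.roots, x ≤ 0) ∧ (∀ x ∈ q.roots, x ≤ 0) ∧
  (∀ (i : ℕ) (hip : i < (rootsDesc p).length) (hiq : i < (rootsDesc q).length),
      (rootsDesc p).get ⟨i, hip⟩ ≤ (rootsDesc q).get ⟨i, hiq⟩) ∧
  (∀ (i : ℕ) (hiq : i + 1 < (rootsDesc q).length) (hip : i < (rootsDesc p).length),
      (rootsDesc q).get ⟨i + 1, hiq⟩ ≤ (rootsDesc p).get ⟨i, hip⟩)

/-- The oriented area `Im (conj a * b)` spanned by two complex numbers. -/
def crossIm (a b : ℂ) : ℝ := a.re * b.im - a.im * b.re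

lemma crossIm_sum_right {ι : Type*} (s : Finset ι) (a : ℂ) (f : ι → ℂ) :
    crossIm a (∑ i ∈ s, f i) = ∑ i ∈ s, crossIm a (f i) := by
  simp only [crossIm, Complex.re_sum, Complex.im_sum, Finset.mul_sum, Finset.sum_sub_distrib]

lemma crossIm_sum_left {ι : Type*} (s : Finset ι) (f : ι → ℂ) (b : ℂ) :
    crossIm (∑ i ∈ s, f i) b = ∑ i ∈ s, crossIm (f i) b := by
  simp only [crossIm, Complex.re_sum, Complex.im_sum, Finset.sum_mul, Finset.sum_sub_distrib]

lemma crossIm_sum_sum_nonneg {ι : Type*} {s t : Finset ι} {f g : ι → ℂ}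
    (h : ∀ i ∈ s, ∀ j ∈ t, 0 ≤ crossIm (f i) (g j)) :
    0 ≤ crossIm (∑ i ∈ s, f i) (∑ j ∈ t, g j) := by
  rw [crossIm_sum_left]
  refine Finset.sum_nonneg fun i hi => ?_
  rw [crossIm_sum_right]
  exact Finset.sum_nonneg fun j hj => h i hi j hj

/-- The values `f 0, …, f (m - 1)` appear in strict counterclockwise order, within the
half-turn sector ending at `z * f 0`. -/
def CyclicallyOrdered (z : ℂ) (m : ℕ) (f : ℕ → ℂ) : Prop :=
  ∀ i j, i < j → j < m → 0 < crossIm (f i) (f j) ∧ 0 ≤ crossIm (f j) (z * f i)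

/-- The Eulerian-type transformation `f ↦ (z ∑_{i<k} f i + ∑_{k≤i<m} f i)_k`. -/
def eulerTransform (z : ℂ) (m : ℕ) (f : ℕ → ℂ) (k : ℕ) : ℂ :=
  z * ∑ i ∈ Finset.range k, f i + ∑ i ∈ Finset.Ico k m, f i

lemma CyclicallyOrdered.sum_Ico_ne_zero {z : ℂ} {m : ℕ} {f : ℕ → ℂ}
    (h : CyclicallyOrdered z m f) (hm : 2 ≤ m) {k l : ℕ} (hkl : k < l) (hl : l ≤ m) :
    ∑ i ∈ Finset.Ico k l, f i ≠ 0 := by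
  intro h0
  rw [Finset.sum_eq_sum_Ico_succ_bot hkl] at h0
  rcases Nat.lt_or_ge (k + 1) l with hlt | hge
  · have h1 : 0 < crossIm (f k) (∑ i ∈ Finset.Ico (k + 1) l, f i) := by
      rw [crossIm_sum_right]
      refine Finset.sum_pos (fun i hi => ?_) ⟨k + 1, by simp [hlt]⟩
      rw [Finset.mem_Ico] at hi
      exact (h k i (by omega) (by omega)).1
    rw [eq_neg_of_add_eq_zero_right h0] at h1
    simp only [crossIm, Complex.neg_im, Complex.neg_re] at h1
    linarith
  · rw [Finset.Ico_eq_empty (by omega), Finset.sum_empty, add_zero] at h0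
    rcases Nat.eq_zero_or_pos k with rfl | hk
    · simpa [crossIm, h0] using (h 0 1 (by omega) (by omega)).1
    · simpa [crossIm, h0] using (h 0 k hk (by omega)).1

lemma CyclicallyOrdered.map_eulerTransform {z : ℂ} (hz : 0 < z.im) {m : ℕ} (hm : 2 ≤ m)
    {f : ℕ → ℂ} (h : CyclicallyOrdered z m f) :
    CyclicallyOrdered z (m + 1) (eulerTransform z m f) := by
  intro k l hkl hl
  have hB0 := h.sum_Ico_ne_zero hm hkl (by omega)
  have hl' : eulerTransform z m f l = z * (∑ i ∈ Finset.range k, f i) +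
      z * (∑ i ∈ Finset.Ico k l, f i) + ∑ i ∈ Finset.Ico l m, f i := by
    rw [eulerTransform, ← Finset.sum_range_add_sum_Ico f hkl.le]; ring
  have hk' : eulerTransform z m f k = z * (∑ i ∈ Finset.range k, f i) +
      (∑ i ∈ Finset.Ico k l, f i) + ∑ i ∈ Finset.Ico l m, f i := by
    rw [eulerTransform, ← Finset.sum_Ico_consecutive f hkl.le (by omega : l ≤ m)]; ring
  have hAB : 0 ≤ crossIm (∑ i ∈ Finset.range k, f i) (∑ i ∈ Finset.Ico k l, f i) :=
    crossIm_sum_sum_nonneg fun i hi j hj => by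
      rw [Finset.mem_range] at hi; rw [Finset.mem_Ico] at hj
      exact (h i j (by omega) (by omega)).1.le
  have hBC : 0 ≤ crossIm (∑ i ∈ Finset.Ico k l, f i) (∑ i ∈ Finset.Ico l m, f i) :=
    crossIm_sum_sum_nonneg fun i hi j hj => by
      rw [Finset.mem_Ico] at hi hj
      exact (h i j (by omega) (by omega)).1.le
  have hBA : 0 ≤ crossIm (∑ i ∈ Finset.Ico k l, f i) (z * ∑ i ∈ Finset.range k, f i) := by
    rw [Finset.mul_sum]
    exact crossIm_sum_sum_nonneg fun i hi j hj => by
      rw [Finset.mem_Ico] at hi; rw [Finset.mem_range] at hj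
      exact (h j i (by omega) (by omega)).2
  have hCB : 0 ≤ crossIm (∑ i ∈ Finset.Ico l m, f i) (z * ∑ i ∈ Finset.Ico k l, f i) := by
    rw [Finset.mul_sum]
    exact crossIm_sum_sum_nonneg fun i hi j hj => by
      rw [Finset.mem_Ico] at hi hj
      exact (h j i (by omega) (by omega)).2
  rw [hl', hk']
  generalize ∑ i ∈ Finset.range k, f i = A at *
  generalize ∑ i ∈ Finset.Ico k l, f i = B at *
  generalize ∑ i ∈ Finset.Ico l m, f i = C at *
  have hB : 0 < z.im * Complex.normSq B := mul_pos hz (Complex.normSq_pos.2 hB0)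
  have hAC : 0 ≤ z.im * Complex.normSq (z * A + C) := mul_nonneg hz.le (Complex.normSq_nonneg _)
  have hzn := Complex.normSq_nonneg z
  constructor
  · have key : crossIm (z * A + B + C) (z * A + z * B + C) =
        z.im * Complex.normSq B + crossIm B (z * A) + Complex.normSq z * crossIm A B +
          crossIm C (z * B) + crossIm B C := by
      simp only [crossIm, Complex.normSq_apply, Complex.add_re, Complex.add_im, Complex.mul_re,
        Complex.mul_im]
      ring
    rw [key]
    have := mul_nonneg hzn hAB
    linarith
  · have key : crossIm (z * A + z * B + C) (z * (z * A + B + C)) =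
        z.im * Complex.normSq (z * A + C) + Complex.normSq z * crossIm B (z * A) +
          Complex.normSq z * crossIm A B + crossIm C (z * B) +
          Complex.normSq z * crossIm B C := by
      simp only [crossIm, Complex.normSq_apply, Complex.add_re, Complex.add_im, Complex.mul_re,
        Complex.mul_im]
      ring
    rw [key]
    have h1 := mul_nonneg hzn hAB
    have h2 := mul_nonneg hzn hBA
    have h3 := mul_nonneg hzn hBC
    linarith

lemma CyclicallyOrdered.smul {z : ℂ} {m : ℕ} {f g : ℕ → ℂ} (h : CyclicallyOrdered z m f)
    (hg : ∀ k < m, ∃ c : ℝ, 0 < c ∧ g k = c * f k) : CyclicallyOrdered z m g := by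
  intro i j hij hj
  obtain ⟨c, hc, hi⟩ := hg i (hij.trans hj)
  obtain ⟨d, hd, hj'⟩ := hg j hj
  obtain ⟨h1, h2⟩ := h i j hij hj
  rw [hi, hj']
  constructor
  · have : crossIm (c * f i) (d * f j) = c * d * crossIm (f i) (f j) := by
      simp [crossIm]; ring
    rw [this]; positivity
  · have : crossIm (d * f j) (z * (c * f i)) = c * d * crossIm (f j) (z * f i) := by
      simp [crossIm]; ring
    rw [this]; positivity

lemma pB_succ (n k : ℕ) (hk : k < n + 3) : ∃ c : ℝ, 0 < c ∧
    pB (n + 1) k = Polynomial.C c * (Polynomial.X * ∑ i ∈ Finset.range k, pB n i +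
      ∑ i ∈ Finset.Ico k (n + 2), pB n i) := by
  rcases k with _ | k
  · exact ⟨1, one_pos, by rw [pB]; simp⟩
  · rw [pB]
    by_cases h : k + 1 ≤ n + 1
    · refine ⟨2, two_pos, ?_⟩
      have : Finset.Icc (k + 1) (n + 1) = Finset.Ico (k + 1) (n + 2) := by
        ext; simp only [Finset.mem_Icc, Finset.mem_Ico]; omega
      rw [if_pos h, this, show (Polynomial.C 2 : Polynomial ℝ) = 2 from rfl]
      ring
    · obtain rfl : k = n + 1 := by omega
      exact ⟨1, one_pos, by simp⟩

lemma pB_cyclicallyOrdered {z : ℂ} (hz : 0 < z.im) (n : ℕ) :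
    CyclicallyOrdered z (n + 2) fun k => Polynomial.aeval z (pB n k) := by
  induction n with
  | zero =>
    intro i j hij hj
    obtain ⟨rfl, rfl⟩ : i = 0 ∧ j = 1 := by omega
    simp [pB, crossIm, hz, mul_comm]
  | succ n ih =>
    refine (ih.map_eulerTransform hz (by omega)).smul fun k hk => ?_
    obtain ⟨c, hc, h⟩ := pB_succ n k hk
    exact ⟨c, hc, by simp [h, eulerTransform]⟩

lemma pB_eval_pos {x : ℝ} (hx : 0 < x) (n k : ℕ) (hk : k < n + 2) : 0 < (pB n k).eval x := by
  induction n generalizing k with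
  | zero => interval_cases k <;> simp [pB, hx]
  | succ n ih =>
    obtain ⟨c, hc, h⟩ := pB_succ n k hk
    rw [h]
    simp only [Polynomial.eval_mul, Polynomial.eval_C, Polynomial.eval_add, Polynomial.eval_X,
      Polynomial.eval_finsetSum]
    refine mul_pos hc ?_
    rcases Nat.eq_zero_or_pos k with rfl | hk0
    · rw [Finset.sum_range_zero, mul_zero, zero_add]
      exact Finset.sum_pos (fun i hi => ih i (Finset.mem_Ico.1 hi).2) ⟨0, by simp⟩
    · refine add_pos_of_pos_of_nonneg (mul_pos hx (Finset.sum_pos (fun i hi => ih i ?_)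
        ⟨0, by simpa⟩)) (Finset.sum_nonneg fun i hi => (ih i (Finset.mem_Ico.1 hi).2).le)
      rw [Finset.mem_range] at hi
      omega

lemma splits_of_aeval_ne_zero {p : Polynomial ℝ}
    (h : ∀ z : ℂ, 0 < z.im → Polynomial.aeval z p ≠ 0) : p.Splits := by
  have hs := IsAlgClosed.splits (p.map (algebraMap ℝ ℂ))
  refine hs.of_splits_map_of_injective (algebraMap ℝ ℂ).injective fun z hz => ?_
  have hz0 : Polynomial.aeval z p = 0 := by
    simpa [Polynomial.aeval_def, Polynomial.eval_map] using (Polynomial.isRoot_of_mem_roots hz)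
  rcases lt_trichotomy z.im 0 with h0 | h0 | h0
  · refine absurd ?_ (h (starRingEnd ℂ z) (by simpa using h0))
    rw [Polynomial.aeval_conj, hz0, map_zero]
  · exact ⟨z.re, Complex.ext (by simp) (by simp [h0])⟩
  · exact absurd hz0 (h z h0)

/-- The total argument of `∏ (z - α)` over a multiset of real numbers `α`. -/
noncomputable def argSum (s : Multiset ℝ) (z : ℂ) : ℝ := (s.map fun α : ℝ => (z - α).arg).sum

lemma prod_sub_eq_norm_mul_exp (s : Multiset ℝ) (z : ℂ) :
    (s.map fun α : ℝ => z - α).prod =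
      ‖(s.map fun α : ℝ => z - α).prod‖ * Complex.exp (argSum s z * Complex.I) := by
  induction s using Multiset.induction with
  | empty => simp [argSum]
  | cons a s ih =>
    have h : argSum (a ::ₘ s) z = (z - a).arg + argSum s z := by simp [argSum]
    rw [h, Multiset.map_cons, Multiset.prod_cons, norm_mul]
    conv_lhs => rw [ih, ← Complex.norm_mul_exp_arg_mul_I (z - a)]
    push_cast
    rw [add_mul, Complex.exp_add]
    ring

lemma continuous_argSum (s : Multiset ℝ) :
    Continuous fun z : UpperHalfPlane => argSum s (z : ℂ) := by
  refine continuous_multiset_sum s fun a _ => ?_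
  refine continuous_iff_continuousAt.2 fun z => ?_
  refine ContinuousAt.comp (g := Complex.arg) (Complex.continuousAt_arg (Or.inr ?_)) ?_
  · simpa using z.im_ne_zero
  · exact (UpperHalfPlane.continuous_coe.sub continuous_const).continuousAt

lemma tendsto_argSum {s : Multiset ℝ} {t : ℝ} (ht : t ∉ s) :
    Filter.Tendsto (fun ε : ℝ => argSum s (t + ε * Complex.I)) (nhdsWithin 0 (Set.Ioi 0))
      (nhds (Real.pi * s.countP (t < ·))) := by
  have hsum : Real.pi * s.countP (t < ·) = (s.map fun α => if t < α then Real.pi else 0).sum := by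
    clear ht
    induction s using Multiset.induction with
    | empty => simp
    | cons a s ih =>
      by_cases h : t < a
      · simp [h, ← ih]; ring
      · simp [h, ← ih]
  rw [hsum]
  refine tendsto_multiset_sum s fun a ha => ?_
  have hlim : Filter.Tendsto (fun ε : ℝ => (t + ε * Complex.I - a : ℂ))
      (nhdsWithin 0 (Set.Ioi 0)) (nhds ((t - a : ℝ) : ℂ)) := by
    have : Continuous fun ε : ℝ => (t + ε * Complex.I - a : ℂ) := by fun_prop
    simpa using (this.tendsto 0).mono_left nhdsWithin_le_nhds
  split_ifs with h
  · refine (Complex.tendsto_arg_nhdsWithin_im_nonneg_of_re_neg_of_im_zero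
      (z := ((t - a : ℝ) : ℂ)) (by simpa using h) (by simp)).comp ?_
    refine tendsto_nhdsWithin_iff.2 ⟨hlim, ?_⟩
    filter_upwards [self_mem_nhdsWithin] with ε hε
    simpa using (Set.mem_Ioi.1 hε).le
  · have hpos : a < t := lt_of_le_of_ne (not_lt.1 h) fun e => ht (e ▸ ha)
    have := (Complex.continuousAt_arg (x := ((t - a : ℝ) : ℂ))
      (Or.inl (by simpa using hpos))).tendsto.comp hlim
    rwa [Complex.arg_ofReal_of_nonneg (by linarith)] at this

lemma aeval_eq_norm_mul_exp {p : Polynomial ℝ} (hp : p.Splits) (hlead : 0 < p.leadingCoeff)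
    (z : ℂ) : Polynomial.aeval z p =
      ‖Polynomial.aeval z p‖ * Complex.exp (argSum p.roots z * Complex.I) := by
  have h : Polynomial.aeval z p = p.leadingCoeff * (p.roots.map fun α : ℝ => z - α).prod := by
    conv_lhs => rw [hp.eq_prod_roots]
    simp [map_multiset_prod, Multiset.map_map]
  rw [h, norm_mul, Complex.norm_real, Real.norm_of_nonneg hlead.le]
  conv_lhs => rw [prod_sub_eq_norm_mul_exp]
  push_cast
  ring

/-- If `crossIm (p z) (q z) > 0` on the upper half-plane, then the arguments of `p` and `q`
differ by an angle in `(0, π)`. -/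
lemma argSum_sub_mem_Ioo {p q : Polynomial ℝ} (hp : p.Splits) (hq : q.Splits)
    (hpl : 0 < p.leadingCoeff) (hql : 0 < q.leadingCoeff)
    (h : ∀ z : ℂ, 0 < z.im → 0 < crossIm (Polynomial.aeval z p) (Polynomial.aeval z q))
    (z : UpperHalfPlane) :
    argSum q.roots (z : ℂ) - argSum p.roots (z : ℂ) ∈ Set.Ioo 0 Real.pi := by
  set θ : UpperHalfPlane → ℝ := fun z => argSum q.roots (z : ℂ) - argSum p.roots (z : ℂ)
    with hθ
  have hcont : Continuous θ := (continuous_argSum _).sub (continuous_argSum _)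
  have hsin : ∀ z, 0 < Real.sin (θ z) := fun z => by
    have hz := h z z.im_pos
    rw [aeval_eq_norm_mul_exp hp hpl, aeval_eq_norm_mul_exp hq hql] at hz
    simp only [crossIm, Complex.re_ofReal_mul, Complex.im_ofReal_mul,
      Complex.exp_ofReal_mul_I_re, Complex.exp_ofReal_mul_I_im] at hz
    have : 0 < (‖Polynomial.aeval (z : ℂ) p‖ * ‖Polynomial.aeval (z : ℂ) q‖) *
        Real.sin (θ z) := by
      rw [hθ, Real.sin_sub]; linarith
    exact pos_of_mul_pos_right this (by positivity)
  obtain ⟨w, hw⟩ : ∃ w, θ w ∈ Set.Ioo (-Real.pi) Real.pi := by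
    obtain ⟨t, ht⟩ := (p.roots + q.roots).toFinset.bddAbove
    have hroot : ∀ a ∈ p.roots + q.roots, a < t + 1 := fun a ha => by
      linarith [ht (by simpa using ha : a ∈ ((p.roots + q.roots).toFinset : Set ℝ))]
    have hlim : ∀ s ≤ p.roots + q.roots, Filter.Tendsto
        (fun ε : ℝ => argSum s ((t + 1 : ℝ) + ε * Complex.I)) (nhdsWithin 0 (Set.Ioi 0))
        (nhds 0) := fun s hs => by
      have hc : s.countP (t + 1 < ·) = 0 :=
        Multiset.countP_eq_zero.2 fun a ha => (hroot a (Multiset.mem_of_le hs ha)).not_gt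
      have := tendsto_argSum (s := s) (t := t + 1)
        fun hm => (hroot _ (Multiset.mem_of_le hs hm)).false
      rwa [hc, Nat.cast_zero, mul_zero] at this
    have hsub := (hlim q.roots (by simp)).sub (hlim p.roots (by simp))
    rw [sub_zero] at hsub
    obtain ⟨ε, hε, hpos⟩ := ((hsub.eventually
      (Ioo_mem_nhds (neg_lt_zero.2 Real.pi_pos) Real.pi_pos)).and self_mem_nhdsWithin).exists
    exact ⟨⟨(t + 1 : ℝ) + ε * Complex.I, by simpa using hpos⟩, hε⟩
  have hw0 : 0 < θ w := by
    by_contra! hle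
    exact (Real.sin_nonpos_of_nonpos_of_neg_pi_le hle hw.1.le).not_gt (hsin w)
  constructor
  · by_contra! hle
    obtain ⟨u, hu⟩ := mem_range_of_exists_le_of_exists_ge hcont ⟨z, hle⟩ ⟨w, hw0.le⟩
    simpa [hu] using hsin u
  · by_contra! hle
    obtain ⟨u, hu⟩ := mem_range_of_exists_le_of_exists_ge hcont ⟨w, hw.2.le⟩ ⟨z, hle⟩
    simpa [hu] using hsin u

lemma countP_roots_of_notMem {p q : Polynomial ℝ} (hp : p.Splits) (hq : q.Splits)
    (hpl : 0 < p.leadingCoeff) (hql : 0 < q.leadingCoeff)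
    (h : ∀ z : ℂ, 0 < z.im → 0 < crossIm (Polynomial.aeval z p) (Polynomial.aeval z q))
    {t : ℝ} (htp : t ∉ p.roots) (htq : t ∉ q.roots) :
    p.roots.countP (t < ·) ≤ q.roots.countP (t < ·) ∧
      q.roots.countP (t < ·) ≤ p.roots.countP (t < ·) + 1 := by
  have hlim := (tendsto_argSum htq).sub (tendsto_argSum htp)
  have hmem : ∀ᶠ ε : ℝ in nhdsWithin 0 (Set.Ioi 0),
      argSum q.roots (t + ε * Complex.I) - argSum p.roots (t + ε * Complex.I) ∈
        Set.Icc 0 Real.pi := by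
    filter_upwards [self_mem_nhdsWithin] with ε hε
    exact Set.Ioo_subset_Icc_self (argSum_sub_mem_Ioo hp hq hpl hql h
      ⟨t + ε * Complex.I, by simpa using hε⟩)
  obtain ⟨h0, h1⟩ := isClosed_Icc.mem_of_tendsto hlim hmem
  rw [← mul_sub] at h0 h1
  have h0' := nonneg_of_mul_nonneg_right h0 Real.pi_pos
  have h1' : (q.roots.countP (t < ·) : ℝ) - p.roots.countP (t < ·) ≤ 1 := by
    by_contra! hc
    nlinarith [Real.pi_pos]
  constructor
  · exact_mod_cast sub_nonneg.1 h0'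
  · exact_mod_cast (by linarith :
      (q.roots.countP (t < ·) : ℝ) ≤ p.roots.countP (t < ·) + 1)

lemma countP_roots {p q : Polynomial ℝ} (hp : p.Splits) (hq : q.Splits)
    (hpl : 0 < p.leadingCoeff) (hql : 0 < q.leadingCoeff)
    (h : ∀ z : ℂ, 0 < z.im → 0 < crossIm (Polynomial.aeval z p) (Polynomial.aeval z q))
    (t : ℝ) :
    p.roots.countP (t < ·) ≤ q.roots.countP (t < ·) ∧
      q.roots.countP (t < ·) ≤ p.roots.countP (t < ·) + 1 := by
  have hev : ∀ᶠ u in nhdsWithin t (Set.Ioi t),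
      ∀ a ∈ (p.roots + q.roots).toFinset, t < a → u < a := by
    rw [Filter.eventually_all_finset]
    intro a _
    by_cases hta : t < a
    · filter_upwards [Ioo_mem_nhdsGT hta] with u hu _ using hu.2
    · exact Filter.Eventually.of_forall fun u hu => absurd hu hta
  obtain ⟨u, hu, htu⟩ := (hev.and self_mem_nhdsWithin).exists
  have htu : t < u := htu
  have hu' : ∀ s ≤ p.roots + q.roots, ∀ a ∈ s, t < a → u < a := fun s hs a ha =>
    hu a (Multiset.mem_toFinset.2 (Multiset.mem_of_le hs ha))
  have hcount : ∀ s ≤ p.roots + q.roots, s.countP (t < ·) = s.countP (u < ·) := fun s hs =>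
    Multiset.countP_congr rfl fun a ha => propext ⟨hu' s hs a ha, htu.trans⟩
  rw [hcount p.roots (by simp), hcount q.roots (by simp)]
  exact countP_roots_of_notMem hp hq hpl hql h
    (fun hm => (hu' p.roots (by simp) u hm htu).false)
    (fun hm => (hu' q.roots (by simp) u hm htu).false)

lemma List.SortedGE.lt_getElem_iff {L : List ℝ} (hL : L.SortedGE) (t : ℝ) {i : ℕ}
    (hi : i < L.length) : t < L[i] ↔ i < L.countP (t < ·) := by
  replace hL := hL.pairwise
  induction L generalizing i with
  | nil => simp at hi
  | cons a L ih =>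
    rw [List.pairwise_cons] at hL
    by_cases ha : t < a
    · rcases i with _ | i
      · simp [ha]
      · simpa [ha] using ih (i := i) (by simpa using hi) hL.2
    · have hle : ∀ b ∈ a :: L, ¬ t < b := by
        intro b hb
        rcases List.mem_cons.1 hb with rfl | hb
        · exact ha
        · exact fun h => ha (h.trans_le (hL.1 b hb))
      have : (a :: L).countP (t < ·) = 0 := List.countP_eq_zero.2 (by simpa using hle)
      rw [this]
      simpa using hle _ (List.getElem_mem hi)

lemma lt_rootsDesc_iff (p : Polynomial ℝ) (t : ℝ) {i : ℕ} (hi : i < (rootsDesc p).length) :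
    t < (rootsDesc p).get ⟨i, hi⟩ ↔ i < p.roots.countP (t < ·) := by
  have hs : (rootsDesc p).SortedGE := by
    simpa [rootsDesc] using (p.roots.pairwise_sort (· ≤ ·)).sortedLE
  have hc : (rootsDesc p).countP (t < ·) = p.roots.countP (t < ·) := by
    rw [← Multiset.coe_countP]
    simp [rootsDesc]
  rw [List.get_eq_getElem, hs.lt_getElem_iff, hc]

theorem Interlaces.of_crossIm_pos {p q : Polynomial ℝ}
    (h : ∀ z : ℂ, 0 < z.im → 0 < crossIm (Polynomial.aeval z p) (Polynomial.aeval z q))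
    (hp : ∀ x : ℝ, 0 < x → 0 < p.eval x) (hq : ∀ x : ℝ, 0 < x → 0 < q.eval x) :
    Interlaces p q := by
  have hps : p.Splits := splits_of_aeval_ne_zero fun z hz h0 => by
    simpa [crossIm, h0] using h z hz
  have hqs : q.Splits := splits_of_aeval_ne_zero fun z hz h0 => by
    simpa [crossIm, h0] using h z hz
  have hroots : ∀ {r : Polynomial ℝ}, (∀ x : ℝ, 0 < x → 0 < r.eval x) → ∀ x ∈ r.roots, x ≤ 0 :=
    fun {r} hr x hx => not_lt.1 fun hx0 => (hr x hx0).ne' (Polynomial.isRoot_of_mem_roots hx)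
  have hlead : ∀ {r : Polynomial ℝ}, r.Splits → (∀ x : ℝ, 0 < x → 0 < r.eval x) →
      0 < r.leadingCoeff := fun {r} hrs hr => by
    have h1 := hr 1 one_pos
    rw [hrs.eval_eq_prod_roots] at h1
    refine pos_of_mul_pos_left h1 (Multiset.prod_nonneg fun a ha => ?_)
    obtain ⟨x, hx, rfl⟩ := Multiset.mem_map.1 ha
    linarith [hroots hr x hx]
  have hpl := hlead hps hp
  have hql := hlead hqs hq
  have hcount := countP_roots hps hqs hpl hql h
  obtain ⟨t, ht⟩ := (p.roots + q.roots).toFinset.bddBelow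
  have hcard : ∀ s ≤ p.roots + q.roots, s.countP (t - 1 < ·) = s.card := fun s hs =>
    Multiset.countP_eq_card.2 fun a ha => by
      have := ht (by simpa using Multiset.mem_of_le hs ha :
        a ∈ ((p.roots + q.roots).toFinset : Set ℝ))
      linarith
  have hdeg := hcount (t - 1)
  rw [hcard p.roots (by simp), hcard q.roots (by simp), ← hps.natDegree_eq_card_roots,
    ← hqs.natDegree_eq_card_roots] at hdeg
  refine ⟨Polynomial.leadingCoeff_ne_zero.1 hpl.ne', Polynomial.leadingCoeff_ne_zero.1 hql.ne',
    hps.natDegree_eq_card_roots.symm, hqs.natDegree_eq_card_roots.symm, hdeg.1, hdeg.2,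
    hroots hp, hroots hq, fun i hip hiq => ?_, fun i hiq hip => ?_⟩
  · by_contra! hlt
    have h1 := (lt_rootsDesc_iff p _ hip).1 hlt
    exact ((lt_rootsDesc_iff q _ hiq).2 (h1.trans_le (hcount _).1)).false
  · by_contra! hlt
    have h1 := (lt_rootsDesc_iff q _ hiq).1 hlt
    have h2 := h1.trans_le (hcount _).2
    exact ((lt_rootsDesc_iff p _ hip).2 (by omega)).false

/-- The sequence `(p^B_{n,0}, p^B_{n,1}, …, p^B_{n,n+1})` is an interlacing sequence of
real-rooted polynomials: `p^B_{n,i}` interlaces `p^B_{n,j}` whenever `0 ≤ i < j ≤ n+1`. -/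
theorem pB_interlacing_sequence (n i j : ℕ) (hij : i < j) (hj : j ≤ n + 1) :
    Interlaces (pB n i) (pB n j) :=
  Interlaces.of_crossIm_pos (fun _ hz => (pB_cyclicallyOrdered hz n i j hij (by omega)).1)
    (fun _ hx => pB_eval_pos hx n i (by omega)) (fun _ hx => pB_eval_pos hx n j (by omega))
end

section
/- Let n be a natural number, let f_0, …, f_n and h_0, …, h_{n+1} be real numbers satisfying the polynomial identity (1+x) · Σ_{k=0}^{n+1} h_k x^k = 1 + Σ_{k=0}^{n} f_k x^{k+1} ((1−x)/2)^{n−k} + h_{n+1} x^{n+2} in ℝ[x], and assume h_k ≥ 0 for all k ∈ {0,1,…,n+1}. Then the polynomial (1−x)^{n+1} + x · Σ_{k=0}^{n} f_k (1−x)^{n−k} B_k(x) is real-rooted and is interlaced by B_n(x). -/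
open Polynomial PowerSeries

/-- Weak intermediate value principle for polynomials: if `q` alternates weakly in sign along a
strictly decreasing sequence, then it has a root, counted with multiplicity, in each gap. -/
theorem exists_prod_dvd_of_sign_alternates (N : ℕ) :
    ∀ (e : ℕ → ℝ) (q : Polynomial ℝ), (∀ i < N, e (i + 1) < e i) → q ≠ 0 →
      (∀ i ≤ N, 0 ≤ (-1) ^ i * q.eval (e i)) →
      ∃ b : ℕ → ℝ, (∀ i < N, e (i + 1) ≤ b i ∧ b i ≤ e i) ∧
        ∏ i ∈ Finset.range N, (Polynomial.X - Polynomial.C (b i)) ∣ q := by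
  induction N with
  | zero => intro e q _ _ _; exact ⟨e, by simp, by simp⟩
  | succ N ih =>
    intro e q he hq hs
    have key : ∃ r, e 1 ≤ r ∧ r ≤ e 0 ∧ ∃ k : Polynomial ℝ,
        q = (Polynomial.X - Polynomial.C r) * k ∧ k.eval (e 1) ≥ 0 := by
      have h01 := he 0 (by omega)
      have h0 := hs 0 (by omega)
      have h1 := hs 1 (by omega)
      simp only [zero_add, pow_zero, one_mul, pow_one, neg_mul, Left.nonneg_neg_iff] at h01 h0 h1
      rcases h0.eq_or_lt with h0 | h0
      · obtain ⟨k, hk⟩ := Polynomial.dvd_iff_isRoot.2 (show q.IsRoot (e 0) from h0.symm)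
        refine ⟨e 0, h01.le, le_rfl, k, hk, ?_⟩
        rw [hk] at h1
        simp only [Polynomial.eval_mul, Polynomial.eval_sub, Polynomial.eval_X,
          Polynomial.eval_C] at h1
        by_contra! hc
        nlinarith
      rcases h1.eq_or_lt with h1 | h1
      · obtain ⟨k, hk⟩ := Polynomial.dvd_iff_isRoot.2 (show q.IsRoot (e 1) from h1)
        by_cases hk1 : 0 ≤ k.eval (e 1)
        · exact ⟨e 1, le_rfl, h01.le, k, hk, hk1⟩
        have hk0 : 0 < k.eval (e 0) := by
          rw [hk] at h0
          simp only [Polynomial.eval_mul, Polynomial.eval_sub, Polynomial.eval_X,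
            Polynomial.eval_C] at h0
          exact (pos_iff_pos_of_mul_pos h0).1 (by linarith)
        obtain ⟨r, ⟨hr1, hr0⟩, hr⟩ := intermediate_value_Icc h01.le k.continuous.continuousOn
          (show (0 : ℝ) ∈ Set.Icc _ _ from ⟨by linarith, hk0.le⟩)
        obtain ⟨l, hl⟩ := Polynomial.dvd_iff_isRoot.2 (show k.IsRoot r from hr)
        refine ⟨r, hr1, hr0, (Polynomial.X - Polynomial.C (e 1)) * l, ?_, by simp⟩
        rw [hk, hl]; ring
      · obtain ⟨r, ⟨hr1, hr0⟩, hr⟩ := intermediate_value_Icc h01.le q.continuous.continuousOn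
          (show (0 : ℝ) ∈ Set.Icc _ _ from ⟨h1.le, h0.le⟩)
        obtain ⟨k, hk⟩ := Polynomial.dvd_iff_isRoot.2 (show q.IsRoot r from hr)
        refine ⟨r, hr1, hr0, k, hk, ?_⟩
        rw [hk] at h1
        simp only [Polynomial.eval_mul, Polynomial.eval_sub, Polynomial.eval_X,
          Polynomial.eval_C] at h1
        by_contra! hc
        nlinarith
    obtain ⟨r, hr1, hr0, k, rfl, hk⟩ := key
    have hanti : ∀ i ≤ N, e (i + 1) ≤ e 1 := by
      intro i hi
      induction i with
      | zero => simp
      | succ i ihi => exact (he (i + 1) (by omega)).le.trans (ihi (by omega))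
    obtain ⟨b, hb, hdvd⟩ := ih (fun i => e (i + 1)) k (fun i hi => he (i + 1) (by omega))
      (right_ne_zero_of_mul hq) (by
        intro i hi
        rcases Nat.eq_zero_or_pos i with rfl | hi0
        · simpa using hk
        have hlt : e (i + 1) < r := by
          obtain ⟨j, rfl⟩ := Nat.exists_eq_add_of_lt hi0
          have h1 := he (0 + j + 1) (by omega)
          have h2 := hanti (0 + j) (by omega)
          linarith
        have h := hs (i + 1) (by omega)
        simp only [Polynomial.eval_mul, Polynomial.eval_sub, Polynomial.eval_X,
          Polynomial.eval_C, pow_succ] at h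
        by_contra! hc
        nlinarith)
    refine ⟨fun i => Nat.casesOn i r b, ?_, ?_⟩
    · intro i hi
      cases i with
      | zero => exact ⟨hr1, hr0⟩
      | succ i => exact hb i (by omega)
    · rw [Finset.prod_range_succ', mul_comm]
      exact mul_dvd_mul_left _ hdvd

/-- A polynomial with positive leading coefficient has the sign `(-1) ^ degree` far to the left. -/
theorem exists_lt_sign_eval (q : Polynomial ℝ) (hq : 0 < q.leadingCoeff) (M : ℝ) :
    ∃ L < M, 0 ≤ (-1) ^ q.natDegree * q.eval L := by
  rcases Nat.eq_zero_or_pos q.natDegree with h0 | h0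
  · refine ⟨M - 1, by linarith, ?_⟩
    rw [Polynomial.eq_C_of_natDegree_eq_zero h0] at hq ⊢
    simpa using hq.le
  set p : Polynomial ℝ := Polynomial.C ((-1) ^ q.natDegree) * q.comp (-Polynomial.X) with hp
  have hnd : p.natDegree = q.natDegree := by
    rw [hp, Polynomial.natDegree_C_mul (by simp), Polynomial.natDegree_comp]; simp
  have hlc : p.leadingCoeff = q.leadingCoeff := by
    rw [hp, Polynomial.leadingCoeff_mul, Polynomial.leadingCoeff_comp (by simp)]
    simp [mul_left_comm, ← mul_pow]
  have ht := p.tendsto_atTop_of_leadingCoeff_nonneg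
    (Polynomial.natDegree_pos_iff_degree_pos.1 (by omega)) (by rw [hlc]; exact hq.le)
  obtain ⟨x, hx0, hx⟩ := ((ht.eventually_ge_atTop 0).and
    (Filter.eventually_gt_atTop (-M))).exists
  exact ⟨-x, by linarith, by simpa [hp] using hx0⟩

/-- A polynomial of degree at most `n + 1` whose signs at `0` and at the negative numbers
`a 0 > ⋯ > a (n - 1)` alternate weakly factors over the reals with roots interlaced by the `a i`. -/
theorem exists_factorization_of_sign_alternates (n : ℕ) (a : ℕ → ℝ) (q : Polynomial ℝ)
    (ha : ∀ i, i + 1 < n → a (i + 1) < a i) (hneg : ∀ i < n, a i < 0) (hq : q ≠ 0)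
    (hdeg : q.natDegree ≤ n + 1) (hlead : 0 ≤ q.coeff (n + 1)) (h0 : 0 ≤ q.eval 0)
    (hs : ∀ i < n, 0 ≤ (-1) ^ (i + 1) * q.eval (a i)) :
    ∃ b : ℕ → ℝ, n ≤ q.natDegree ∧
      q = Polynomial.C q.leadingCoeff *
        ∏ i ∈ Finset.range q.natDegree, (Polynomial.X - Polynomial.C (b i)) ∧
      (∀ i < q.natDegree, b i ≤ 0) ∧ (∀ i < n, a i ≤ b i) ∧
      (∀ i < n, i + 1 < q.natDegree → b (i + 1) ≤ a i) := by
  obtain ⟨N, e, hN, hnN, heN, he0, he1, hes⟩ : ∃ (N : ℕ) (e : ℕ → ℝ), q.natDegree ≤ N ∧ n ≤ N ∧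
      (∀ i < N, e (i + 1) < e i) ∧ e 0 = 0 ∧ (∀ i < n, e (i + 1) = a i) ∧
      (∀ i ≤ N, 0 ≤ (-1) ^ i * q.eval (e i)) := by
    by_cases hd : q.natDegree ≤ n
    · refine ⟨n, fun i => Nat.casesOn i 0 a, hd, le_rfl, ?_, rfl, fun i _ => rfl, ?_⟩
      · intro i hi
        cases i with
        | zero => exact hneg 0 hi
        | succ i => exact ha i hi
      · intro i hi
        cases i with
        | zero => simpa using h0
        | succ i => exact hs i hi
    · have hd' : q.natDegree = n + 1 := by omega
      have hl : 0 < q.leadingCoeff := by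
        refine lt_of_le_of_ne ?_ (Polynomial.leadingCoeff_ne_zero.2 hq).symm
        rwa [Polynomial.leadingCoeff, hd']
      obtain ⟨L, hL, hLs⟩ := exists_lt_sign_eval q hl (if n = 0 then 0 else a (n - 1))
      refine ⟨n + 1, fun i => Nat.casesOn i 0 (fun j => if j < n then a j else L), hd'.le,
        by omega, ?_, rfl, fun i hi => by simp [hi], ?_⟩
      · intro i hi
        cases i with
        | zero =>
          by_cases hn : 0 < n
          · simpa [hn] using hneg 0 hn
          · obtain rfl : n = 0 := by omega
            simpa using hL
        | succ i =>
          by_cases hn : i + 1 < n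
          · simpa [hn, show i < n by omega] using ha i hn
          · obtain rfl : n = i + 1 := by omega
            simpa using hL
      · intro i hi
        cases i with
        | zero => simpa using h0
        | succ i =>
          by_cases hn : i < n
          · simpa [hn] using hs i hn
          · obtain rfl : i = n := by omega
            simpa [hd'] using hLs
  obtain ⟨b, hb, k, hk⟩ := exists_prod_dvd_of_sign_alternates N e q heN hq hes
  set P := ∏ i ∈ Finset.range N, (Polynomial.X - Polynomial.C (b i)) with hP
  have hPm : P.Monic := Polynomial.monic_prod_of_monic _ _ fun i _ => Polynomial.monic_X_sub_C _
  have hPd : P.natDegree = N := by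
    rw [hP, Polynomial.natDegree_prod_of_monic _ _ fun i _ => Polynomial.monic_X_sub_C _]; simp
  have hk0 : k ≠ 0 := by rintro rfl; simp [hk] at hq
  have hqd : q.natDegree = N + k.natDegree := by rw [hk, hPm.natDegree_mul' hk0, hPd]
  have hqN : q.natDegree = N := by omega
  have hkC := Polynomial.eq_C_of_natDegree_eq_zero (show k.natDegree = 0 by omega)
  have hlc : q.leadingCoeff = k.coeff 0 := by
    rw [hk, Polynomial.leadingCoeff_mul, hPm.leadingCoeff, one_mul, hkC]; simp
  have hb0 : ∀ i < N, e i ≤ 0 := by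
    intro i hi
    induction i with
    | zero => exact he0.le
    | succ i ihi => exact (heN i (by omega)).le.trans (ihi (by omega))
  refine ⟨b, by omega, ?_, fun i hi => ?_, fun i hi => ?_, fun i hi hi' => ?_⟩
  · rw [hlc, hqN, ← hkC, mul_comm]; exact hk
  · exact (hb i (by omega)).2.trans (hb0 i (by omega))
  · exact (he1 i hi).symm.le.trans (hb i (by omega)).1
  · exact (hb (i + 1) (by omega)).2.trans (he1 i hi).le

theorem roots_C_mul_prod_X_sub_C (N : ℕ) (b : ℕ → ℝ) (c : ℝ) (hc : c ≠ 0) :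
    (Polynomial.C c * ∏ i ∈ Finset.range N, (Polynomial.X - Polynomial.C (b i))).roots =
      ((List.range N).map b : Multiset ℝ) := by
  rw [Polynomial.roots_C_mul _ hc, Polynomial.roots_prod _ _
    (Polynomial.monic_prod_of_monic _ _ fun i _ => Polynomial.monic_X_sub_C _).ne_zero]
  simp only [Polynomial.roots_X_sub_C, Multiset.bind_singleton, Finset.range_val]
  rfl

theorem rootsDesc_eq_map_range (N : ℕ) (b : ℕ → ℝ) (c : ℝ) (hc : c ≠ 0)
    (hb : ∀ i, i + 1 < N → b (i + 1) ≤ b i) :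
    rootsDesc (Polynomial.C c * ∏ i ∈ Finset.range N, (Polynomial.X - Polynomial.C (b i))) =
      (List.range N).map b := by
  have hmono : ∀ i j, i ≤ j → j < N → b j ≤ b i := by
    intro i j hij
    induction j, hij using Nat.le_induction with
    | base => intro _; rfl
    | succ j _ ih => intro hj; exact (hb j hj).trans (ih (by omega))
  rw [rootsDesc, roots_C_mul_prod_X_sub_C N b c hc, List.reverse_eq_iff]
  refine List.Perm.eq_of_pairwise' (r := (· ≤ ·)) (Multiset.pairwise_sort _ _) ?_ ?_
  · rw [List.pairwise_reverse, List.pairwise_map]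
    refine List.Pairwise.imp_of_mem ?_ List.pairwise_lt_range
    intro i j _ hj hij
    exact hmono i j hij.le (List.mem_range.1 hj)
  · rw [← Multiset.coe_eq_coe, Multiset.sort_eq, Multiset.coe_reverse]

theorem realRooted_C_mul_prod (N : ℕ) (b : ℕ → ℝ) (c : ℝ) (hc : c ≠ 0) :
    RealRooted (Polynomial.C c *
      ∏ i ∈ Finset.range N, (Polynomial.X - Polynomial.C (b i))) := by
  intro z hz
  simp only [map_mul, map_prod, map_sub, Polynomial.aeval_C, Polynomial.aeval_X, mul_eq_zero,
    Finset.prod_eq_zero_iff] at hz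
  rcases hz with hz | ⟨i, _, hz⟩
  · simp [hc] at hz
  · rw [sub_eq_zero.1 hz]; simp

theorem natDegree_C_mul_prod_X_sub_C (N : ℕ) (b : ℕ → ℝ) (c : ℝ) (hc : c ≠ 0) :
    (Polynomial.C c *
      ∏ i ∈ Finset.range N, (Polynomial.X - Polynomial.C (b i))).natDegree = N := by
  rw [Polynomial.natDegree_C_mul hc,
    Polynomial.natDegree_prod_of_monic _ _ fun i _ => Polynomial.monic_X_sub_C _]
  simp

theorem realRooted_and_interlaces_of_sign_alternates (n : ℕ) (a : ℕ → ℝ) (q : Polynomial ℝ)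
    (ha : ∀ i, i + 1 < n → a (i + 1) < a i) (hneg : ∀ i < n, a i < 0) (hq : q ≠ 0)
    (hdeg : q.natDegree ≤ n + 1) (hlead : 0 ≤ q.coeff (n + 1)) (h0 : 0 ≤ q.eval 0)
    (hs : ∀ i < n, 0 ≤ (-1) ^ (i + 1) * q.eval (a i)) :
    RealRooted q ∧
      Interlaces (∏ i ∈ Finset.range n, (Polynomial.X - Polynomial.C (a i))) q := by
  obtain ⟨b, hnN, hqb, hb0, hab, hba⟩ :=
    exists_factorization_of_sign_alternates n a q ha hneg hq hdeg hlead h0 hs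
  have hc : q.leadingCoeff ≠ 0 := Polynomial.leadingCoeff_ne_zero.2 hq
  generalize q.leadingCoeff = c at hqb hc
  generalize hN : q.natDegree = N at *
  subst hqb
  have hbb : ∀ i, i + 1 < N → b (i + 1) ≤ b i := fun i hi =>
    (hba i (by omega) hi).trans (hab i (by omega))
  have hda := rootsDesc_eq_map_range n a 1 one_ne_zero fun i hi => (ha i hi).le
  have hra := roots_C_mul_prod_X_sub_C n a 1 one_ne_zero
  have hna := natDegree_C_mul_prod_X_sub_C n a 1 one_ne_zero
  rw [map_one, one_mul] at hda hra hna
  have hdb := rootsDesc_eq_map_range N b c hc hbb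
  have hrb := roots_C_mul_prod_X_sub_C N b c hc
  refine ⟨realRooted_C_mul_prod N b c hc, ?_, hq, ?_, ?_, by omega, by omega, ?_, ?_, ?_, ?_⟩
  · exact (Polynomial.monic_prod_of_monic _ _ fun i _ => Polynomial.monic_X_sub_C _).ne_zero
  · rw [hra, hna]; simp
  · rw [hrb, hN]; simp
  · rw [hra]
    simpa using fun i hi => (hneg i hi).le
  · rw [hrb]
    simpa using hb0
  · intro i hip hiq
    simp only [hda, List.length_map, List.length_range] at hip
    simpa [hda, hdb] using hab i hip
  · intro i hiq hip
    simp only [hda, hdb, List.length_map, List.length_range] at hip hiq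
    simpa [hda, hdb] using hba i hip hiq

/-- The operator on numerators which multiplies the `m`-th coefficient of
`g / (1 - x) ^ (n + 1)` by `2 * m + c`. -/
noncomputable def numeratorOp (n : ℕ) (c : ℝ) (g : Polynomial ℝ) : Polynomial ℝ :=
  2 * Polynomial.X * (1 - Polynomial.X) * Polynomial.derivative g +
    (Polynomial.C c + Polynomial.C (2 * n + 2 - c) * Polynomial.X) * g

theorem coe_numeratorOp (n : ℕ) (c : ℝ) (g : Polynomial ℝ) (u : ℕ → ℝ)
    (hg : (g : PowerSeries ℝ) = (1 - PowerSeries.X) ^ (n + 1) * PowerSeries.mk u) :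
    (numeratorOp n c g : PowerSeries ℝ) =
      (1 - PowerSeries.X) ^ (n + 2) * PowerSeries.mk (fun m => (2 * m + c) * u m) := by
  have hu : PowerSeries.mk (fun m : ℕ => (2 * m + c) * u m) =
      2 * PowerSeries.X * PowerSeries.derivative ℝ (PowerSeries.mk u) +
        PowerSeries.C c * PowerSeries.mk u := by
    ext m
    have h2 : (2 : PowerSeries ℝ) = PowerSeries.C 2 := (map_ofNat _ 2).symm
    rw [h2, mul_assoc]
    cases m with
    | zero => simp [PowerSeries.coeff_mk]
    | succ m =>
      simp only [PowerSeries.coeff_mk, map_add, PowerSeries.coeff_C_mul,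
        PowerSeries.coeff_succ_X_mul, PowerSeries.coeff_derivative]
      push_cast
      ring
  have hd : ((Polynomial.derivative g : Polynomial ℝ) : PowerSeries ℝ) =
      (1 - PowerSeries.X) ^ (n + 1) * PowerSeries.derivative ℝ (PowerSeries.mk u) -
        (n + 1 : PowerSeries ℝ) * (1 - PowerSeries.X) ^ n * PowerSeries.mk u := by
    rw [← PowerSeries.derivative_coe, hg, Derivation.leibniz, PowerSeries.derivative_pow]
    simp only [smul_eq_mul, map_sub, PowerSeries.derivative_one, PowerSeries.derivative_X]
    push_cast [Nat.add_sub_cancel]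
    ring
  have hC : (PowerSeries.C (2 * n + 2 - c : ℝ)) = (2 * n + 2 - PowerSeries.C c : PowerSeries ℝ) := by
    simp [map_ofNat (PowerSeries.C (R := ℝ)) 2]
  have h2 : ((2 : Polynomial ℝ) : PowerSeries ℝ) = 2 :=
    map_ofNat Polynomial.coeToPowerSeries.ringHom 2
  rw [numeratorOp, hu]
  push_cast
  rw [hd, hg, hC, h2]
  ring

theorem coeff_numeratorOp_succ (n d : ℕ) (c : ℝ) (g : Polynomial ℝ) :
    (numeratorOp n c g).coeff (d + 1) =
      (2 * d + 2 + c) * g.coeff (d + 1) + (2 * n + 2 - c - 2 * d) * g.coeff d := by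
  have h : numeratorOp n c g = Polynomial.C 2 * (Polynomial.X * Polynomial.derivative g) -
      Polynomial.C 2 * (Polynomial.X * (Polynomial.X * Polynomial.derivative g)) +
      Polynomial.C c * g + Polynomial.C (2 * n + 2 - c) * (Polynomial.X * g) := by
    rw [numeratorOp, map_ofNat]; ring
  rw [h]
  generalize (2 * n + 2 - c : ℝ) = e
  cases d with
  | zero => simp [Polynomial.coeff_derivative]; ring
  | succ d => simp [Polynomial.coeff_derivative]; ring

theorem natDegree_numeratorOp_le (n d : ℕ) (c : ℝ) (g : Polynomial ℝ) (hg : g.natDegree ≤ d) :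
    (numeratorOp n c g).natDegree ≤ d + 1 := by
  rw [Polynomial.natDegree_le_iff_coeff_eq_zero]
  intro N hN
  obtain ⟨m, rfl⟩ : ∃ m, N = m + 1 := ⟨N - 1, by omega⟩
  rw [coeff_numeratorOp_succ, Polynomial.coeff_eq_zero_of_natDegree_lt (by omega),
    Polynomial.coeff_eq_zero_of_natDegree_lt (by omega)]
  simp

/-- The sign of a product of linear factors is determined by the number of roots above `x`. -/
theorem neg_one_pow_mul_prod_sub_pos (s : Finset ℕ) (a : ℕ → ℝ) (x : ℝ) (i : ℕ)
    (hi : Finset.range i ⊆ s) (hlt : ∀ j ∈ s, j < i → x < a j)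
    (hgt : ∀ j ∈ s, i ≤ j → a j < x) : 0 < (-1) ^ i * ∏ j ∈ s, (x - a j) := by
  have h : (-1 : ℝ) ^ i = ∏ j ∈ s, (if j < i then -1 else 1 : ℝ) := by
    rw [← Finset.prod_filter, Finset.prod_const]
    congr 1
    rw [show s.filter (· < i) = Finset.range i from ?_, Finset.card_range]
    ext j
    simp only [Finset.mem_filter, Finset.mem_range, and_iff_right_iff_imp]
    exact fun hj => hi (Finset.mem_range.2 hj)
  rw [h, ← Finset.prod_mul_distrib]
  refine Finset.prod_pos fun j hj => ?_
  split_ifs with hji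
  · have := hlt j hj hji; linarith
  · have := hgt j hj (by omega); linarith

/-- Nonnegative expansion of a polynomial whose signs at the nodes alternate. -/
theorem exists_nonneg_nodal_expansion (n : ℕ) (a : ℕ → ℝ) (g : Polynomial ℝ)
    (ha : ∀ i j, i < j → j < n → a j < a i) (hdeg : g.natDegree < n)
    (hs : ∀ i < n, 0 ≤ (-1) ^ i * g.eval (a i)) :
    ∃ w : ℕ → ℝ, (∀ i < n, 0 ≤ w i) ∧ g = ∑ i ∈ Finset.range n,
      Polynomial.C (w i) * Lagrange.nodal ((Finset.range n).erase i) a := by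
  have hinj : Set.InjOn a (Finset.range n) := by
    intro i hi j hj hij
    simp only [Finset.coe_range, Set.mem_Iio] at hi hj
    rcases lt_trichotomy i j with h | h | h
    · exact absurd hij (ha i j h hj).ne'
    · exact h
    · exact absurd hij (ha j i h hi).ne
  refine ⟨fun i => Lagrange.nodalWeight (Finset.range n) a i * g.eval (a i), fun i hi => ?_, ?_⟩
  · have hpos := neg_one_pow_mul_prod_sub_pos ((Finset.range n).erase i) a (a i) i
      (fun j hj => by simp only [Finset.mem_range, Finset.mem_erase] at *; omega)
      (fun j hj hji => ha j i hji hi)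
      (fun j hj hij => by
        simp only [Finset.mem_range, Finset.mem_erase] at hj
        exact ha i j (by omega) hj.2)
    have h := hs i hi
    have hsq : ((-1 : ℝ) ^ i) * (-1) ^ i = 1 := by rw [← mul_pow]; simp
    change 0 ≤ Lagrange.nodalWeight _ _ _ * _
    rw [Lagrange.nodalWeight_eq_eval_nodal_erase_inv, Lagrange.eval_nodal]
    set P := ∏ j ∈ (Finset.range n).erase i, (a i - a j)
    have : P⁻¹ * g.eval (a i) = ((-1) ^ i * P)⁻¹ * ((-1) ^ i * g.eval (a i)) := by
      have h1 : ((-1 : ℝ) ^ i)⁻¹ = (-1) ^ i := inv_eq_of_mul_eq_one_left hsq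
      rw [mul_inv, h1]
      linear_combination (-(P⁻¹ * g.eval (a i))) * hsq
    rw [this]
    positivity
  · have hg := Lagrange.eq_interpolate (f := g) hinj (by
      rw [Finset.card_range]
      exact (Polynomial.degree_le_natDegree).trans_lt (by exact_mod_cast hdeg))
    conv_lhs => rw [hg, Lagrange.interpolate_eq_nodalWeight_mul_nodal_div_X_sub_C]
    refine Finset.sum_congr rfl fun i hi => ?_
    rw [← Lagrange.nodal_erase_eq_nodal_div hi, map_mul]
    ring

/-- The operators `numeratorOp n c`, `1 ≤ c ≤ 3`, preserve the sign pattern of a polynomial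
interlacing `B` at the negative roots of `numeratorOp n 1 B`. -/
theorem eval_numeratorOp_mul_nonneg (n : ℕ) (c : ℝ) (hc1 : 1 ≤ c) (hc3 : c ≤ 3) (a : ℕ → ℝ)
    (g : Polynomial ℝ) (ha : ∀ i j, i < j → j < n → a j < a i) (hneg : ∀ i < n, a i < 0)
    (hdeg : g.natDegree < n) (hs : ∀ i < n, 0 ≤ (-1) ^ i * g.eval (a i)) (x : ℝ) (hx : x < 0)
    (hroot : (numeratorOp n 1 (Lagrange.nodal (Finset.range n) a)).eval x = 0) :
    0 ≤ (numeratorOp n c g).eval x * (Lagrange.nodal (Finset.range n) a).eval x := by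
  obtain ⟨w, hw, hg⟩ := exists_nonneg_nodal_expansion n a g ha hdeg hs
  set B := Lagrange.nodal (Finset.range n) a with hB
  have hlin : (numeratorOp n c g).eval x * B.eval x = ∑ i ∈ Finset.range n, w i *
      ((numeratorOp n c (Lagrange.nodal ((Finset.range n).erase i) a)).eval x * B.eval x) := by
    conv_lhs => rw [hg]
    simp only [numeratorOp, Polynomial.derivative_sum, Polynomial.derivative_C_mul,
      Polynomial.eval_add, Polynomial.eval_mul, Polynomial.eval_finsetSum, Polynomial.eval_C]
    rw [Finset.mul_sum, Finset.mul_sum, ← Finset.sum_add_distrib, Finset.sum_mul]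
    exact Finset.sum_congr rfl fun i _ => by ring
  rw [hlin]
  refine Finset.sum_nonneg fun i hi => mul_nonneg (hw i (Finset.mem_range.1 hi)) ?_
  set b := Lagrange.nodal ((Finset.range n).erase i) a
  have hBb : B = (Polynomial.X - Polynomial.C (a i)) * b := Lagrange.nodal_eq_mul_nodal_erase hi
  have hai := hneg i (Finset.mem_range.1 hi)
  have h2 : (numeratorOp n c b).eval x * B.eval x =
      (1 - x) * (b.eval x) ^ 2 * ((c - 3) * x - (c - 1) * a i) := by
    have h3 : (numeratorOp n c b).eval x * B.eval x - (numeratorOp n 1 B).eval x * b.eval x =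
        (1 - x) * (b.eval x) ^ 2 * ((c - 3) * x - (c - 1) * a i) := by
      rw [hBb]
      simp only [numeratorOp, Polynomial.derivative_mul, Polynomial.derivative_sub,
        Polynomial.derivative_X, Polynomial.derivative_C, Polynomial.eval_add,
        Polynomial.eval_sub, Polynomial.eval_mul, Polynomial.eval_C, Polynomial.eval_X,
        Polynomial.eval_one, Polynomial.eval_ofNat, Polynomial.eval_zero]
      ring
    rw [← h3, hroot]; ring
  rw [h2]
  have h4 : 0 ≤ (c - 3) * x := mul_nonneg_of_nonpos_of_nonpos (by linarith) hx.le
  have h5 : (c - 1) * a i ≤ 0 := mul_nonpos_of_nonneg_of_nonpos (by linarith) hai.le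
  have h6 : 0 ≤ (1 - x) * (b.eval x) ^ 2 := mul_nonneg (by linarith) (sq_nonneg _)
  exact mul_nonneg h6 (by linarith)

theorem lt_of_succ_lt (n : ℕ) (a : ℕ → ℝ) (ha : ∀ i, i + 1 < n → a (i + 1) < a i) :
    ∀ i j, i < j → j < n → a j < a i := by
  intro i j hij
  induction j, hij using Nat.le_induction with
  | base => exact ha i
  | succ j _ ih => intro hj; exact (ha j hj).trans (ih (by omega))

theorem eulerianB_zero (B : ℕ → Polynomial ℝ)
    (hB : ∀ k, (B k : PowerSeries ℝ) =
      (1 - PowerSeries.X) ^ (k + 1) * PowerSeries.mk (fun m => ((2 * m + 1 : ℝ)) ^ k)) :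
    B 0 = 1 := by
  apply Polynomial.coe_injective ℝ
  rw [hB 0]
  simpa [mul_comm, Pi.one_def] using PowerSeries.mk_one_mul_one_sub_eq_one ℝ

theorem eulerianB_succ (B : ℕ → Polynomial ℝ)
    (hB : ∀ k, (B k : PowerSeries ℝ) =
      (1 - PowerSeries.X) ^ (k + 1) * PowerSeries.mk (fun m => ((2 * m + 1 : ℝ)) ^ k)) (n : ℕ) :
    B (n + 1) = numeratorOp n 1 (B n) := by
  apply Polynomial.coe_injective ℝ
  rw [hB (n + 1), coe_numeratorOp n 1 _ _ (hB n)]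
  simp only [pow_succ']

/-- The type `B` Eulerian polynomial of degree `n` has simple negative roots, and the numerators
of `∑ 4 (m + 1) (2 m + 1) ^ k (2 m + 3) ^ (n - 1 - k) x ^ m` alternate in sign at them. -/
theorem exists_roots_eulerianB (B : ℕ → Polynomial ℝ)
    (hB : ∀ k, (B k : PowerSeries ℝ) =
      (1 - PowerSeries.X) ^ (k + 1) * PowerSeries.mk (fun m => ((2 * m + 1 : ℝ)) ^ k)) (n : ℕ) :
    ∃ a : ℕ → ℝ, (∀ i j, i < j → j < n → a j < a i) ∧ (∀ i < n, a i < 0) ∧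
      B n = Lagrange.nodal (Finset.range n) a ∧
      ∀ k < n, ∃ g : Polynomial ℝ, g.natDegree < n ∧
        (g : PowerSeries ℝ) = (1 - PowerSeries.X) ^ (n + 1) * PowerSeries.mk
          (fun m => 4 * (m + 1 : ℝ) * (2 * m + 1) ^ k * (2 * m + 3) ^ (n - 1 - k)) ∧
        ∀ i < n, 0 ≤ (-1) ^ i * g.eval (a i) := by
  induction n with
  | zero => exact ⟨fun _ => 0, by simp, by simp, by simp [eulerianB_zero B hB], by simp⟩
  | succ n ih =>
    obtain ⟨a, ha, hneg, hBn, hg⟩ := ih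
    have hrec := eulerianB_succ B hB n
    rw [hBn] at hrec
    set P := Lagrange.nodal (Finset.range n) a with hP
    have hPd : P.natDegree = n := by rw [hP, Lagrange.natDegree_nodal, Finset.card_range]
    have hQle : (B (n + 1)).natDegree ≤ n + 1 := hrec ▸ natDegree_numeratorOp_le n n 1 P hPd.le
    have hQc : (B (n + 1)).coeff (n + 1) = 1 := by
      have hP1 : P.coeff n = 1 := by
        rw [← hPd]; exact Lagrange.nodal_monic
      rw [hrec, coeff_numeratorOp_succ, hP1,
        Polynomial.coeff_eq_zero_of_natDegree_lt (by omega : P.natDegree < n + 1)]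
      ring
    have hQd : (B (n + 1)).natDegree = n + 1 :=
      le_antisymm hQle (Polynomial.le_natDegree_of_ne_zero (by rw [hQc]; exact one_ne_zero))
    have hQlc : (B (n + 1)).leadingCoeff = 1 := by rw [Polynomial.leadingCoeff, hQd, hQc]
    have hQ0 : 0 < (B (n + 1)).eval 0 := by
      have : (B (n + 1)).eval 0 = P.eval 0 := by rw [hrec]; simp [numeratorOp]
      rw [this, hP, Lagrange.eval_nodal]
      exact Finset.prod_pos fun i hi => by linarith [hneg i (Finset.mem_range.1 hi)]
    have hQa : ∀ i < n, 0 < (-1) ^ (i + 1) * (B (n + 1)).eval (a i) := by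
      intro i hi
      have hpos := neg_one_pow_mul_prod_sub_pos ((Finset.range n).erase i) a (a i) i
        (fun j hj => by simp only [Finset.mem_range, Finset.mem_erase] at *; omega)
        (fun j hj hji => ha j i hji hi)
        (fun j hj hij => by
          simp only [Finset.mem_range, Finset.mem_erase] at hj
          exact ha i j (by omega) hj.2)
      rw [← Lagrange.eval_nodal, ← Lagrange.eval_nodal_derivative_eval_node_eq
        (Finset.mem_range.2 hi), ← hP] at hpos
      have hPa : P.eval (a i) = 0 := Lagrange.eval_nodal_at_node (Finset.mem_range.2 hi)
      have hQ : (-1) ^ (i + 1) * (B (n + 1)).eval (a i) =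
          2 * (-a i) * (1 - a i) * ((-1) ^ i * (Polynomial.derivative P).eval (a i)) := by
        rw [hrec]
        simp [numeratorOp, hPa]
        ring
      have := hneg i hi
      rw [hQ]
      exact mul_pos (mul_pos (by linarith) (by linarith)) hpos
    have hQne : B (n + 1) ≠ 0 := fun h => by simp [h] at hQ0
    obtain ⟨b, -, hQb, hb0, hab, hba⟩ := exists_factorization_of_sign_alternates n a (B (n + 1))
      (fun i hi => ha i (i + 1) (by omega) hi) hneg hQne hQle (by rw [hQc]; exact zero_le_one)
      hQ0.le fun i hi => (hQa i hi).le
    rw [hQlc, map_one, one_mul, hQd] at hQb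
    rw [hQd] at hb0 hba
    have hroot : ∀ i < n + 1, (B (n + 1)).eval (b i) = 0 := fun i hi => by
      rw [hQb]; exact Lagrange.eval_nodal_at_node (v := b) (Finset.mem_range.2 hi)
    have hane : ∀ i < n, ∀ j < n + 1, b j ≠ a i := fun i hi j hj h => by
      have := hQa i hi
      rw [← h, hroot j hj] at this
      simp at this
    have hab' : ∀ i < n, a i < b i := fun i hi =>
      (hab i hi).lt_of_ne (hane i hi i (by omega)).symm
    have hba' : ∀ i < n, b (i + 1) < a i := fun i hi =>
      (hba i hi (by omega)).lt_of_ne (hane i hi (i + 1) (by omega))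
    have hbneg : ∀ i < n + 1, b i < 0 := fun i hi =>
      (hb0 i hi).lt_of_ne fun h => by
        have := hroot i hi
        rw [h] at this
        exact hQ0.ne' this
    have hbanti := lt_of_succ_lt (n + 1) b fun i hi =>
      (hba' i (by omega)).trans (hab' i (by omega))
    have hPb : ∀ i < n + 1, 0 < (-1) ^ i * P.eval (b i) := by
      intro i hi
      rw [hP, Lagrange.eval_nodal]
      refine neg_one_pow_mul_prod_sub_pos _ a (b i) i
        (fun j hj => by simp only [Finset.mem_range] at *; omega) ?_ ?_
      · intro j hj hji
        have h1 := hba' j (Finset.mem_range.1 hj)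
        rcases (show j + 1 ≤ i from hji).eq_or_lt with rfl | h
        · exact h1
        · exact (hbanti _ _ h hi).trans h1
      · intro j hj hij
        have hj := Finset.mem_range.1 hj
        rcases hij.eq_or_lt with rfl | h
        · exact hab' i hj
        · exact (ha i j h hj).trans (hab' i (by omega))
    have hstep : ∀ c : ℝ, 1 ≤ c → c ≤ 3 → ∀ g : Polynomial ℝ, g.natDegree < n →
        (∀ i < n, 0 ≤ (-1) ^ i * g.eval (a i)) →
        ∀ i < n + 1, 0 ≤ (-1) ^ i * (numeratorOp n c g).eval (b i) := by
      intro c hc1 hc3 g hgd hgs i hi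
      have h := eval_numeratorOp_mul_nonneg n c hc1 hc3 a g ha hneg hgd hgs (b i) (hbneg i hi)
        (by rw [← hP, ← hrec]; exact hroot i hi)
      refine nonneg_of_mul_nonneg_left (b := (-1) ^ i * P.eval (b i)) ?_ (hPb i hi)
      have hsq : ((-1 : ℝ) ^ i) * (-1) ^ i = 1 := by rw [← mul_pow]; simp
      calc (0 : ℝ) ≤ _ := h
        _ = _ := by
          linear_combination (-((numeratorOp n c g).eval (b i) * P.eval (b i))) * hsq
    refine ⟨b, hbanti, hbneg, hQb, fun k hk => ?_⟩
    rcases Nat.lt_succ_iff_lt_or_eq.1 hk with hk | rfl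
    · obtain ⟨g, hgd, hgc, hgs⟩ := hg k hk
      refine ⟨numeratorOp n 3 g,
        (natDegree_numeratorOp_le n _ 3 g (Nat.le_sub_one_of_lt hgd)).trans_lt (by omega), ?_,
        hstep 3 (by norm_num) le_rfl g hgd hgs⟩
      rw [coe_numeratorOp n 3 g _ hgc]
      congr 2
      funext m
      rw [show n + 1 - 1 - k = (n - 1 - k) + 1 by omega, pow_succ]
      ring
    · rcases Nat.eq_zero_or_pos k with rfl | hk0
      · refine ⟨Polynomial.C 4, by simp, ?_, ?_⟩
        · have h1 : (PowerSeries.mk fun m : ℕ => (m + 1 : ℝ)) * (1 - PowerSeries.X) ^ 2 = 1 := by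
            have h := PowerSeries.mk_add_choose_mul_one_sub_pow_eq_one ℝ 1
            simpa [add_comm] using h
          have h2 : (PowerSeries.mk fun m : ℕ =>
              4 * (m + 1 : ℝ) * (2 * m + 1) ^ 0 * (2 * m + 3) ^ (0 + 1 - 1 - 0)) =
              PowerSeries.C 4 * PowerSeries.mk fun m : ℕ => (m + 1 : ℝ) := by
            ext m; simp
          rw [h2, Polynomial.coe_C]
          linear_combination (-PowerSeries.C 4) * h1
        · intro i hi
          obtain rfl : i = 0 := by omega
          simp
      · obtain ⟨g, hgd, hgc, hgs⟩ := hg (k - 1) (by omega)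
        refine ⟨numeratorOp k 1 g,
          (natDegree_numeratorOp_le k _ 1 g (Nat.le_sub_one_of_lt hgd)).trans_lt (by omega), ?_,
          hstep 1 le_rfl (by norm_num) g hgd hgs⟩
        rw [coe_numeratorOp k 1 g _ hgc]
        congr 2
        funext m
        obtain ⟨l, rfl⟩ : ∃ l, k = l + 1 := ⟨k - 1, by omega⟩
        simp [pow_succ]
        ring

theorem sum_face_numbers_eq (n : ℕ) (f h : ℕ → ℝ)
    (hdef : (1 + Polynomial.X) * ∑ k ∈ Finset.range (n + 2), Polynomial.C (h k) * Polynomial.X ^ k =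
      1 + (∑ k ∈ Finset.range (n + 1), Polynomial.C (f k) * Polynomial.X ^ (k + 1) *
            (Polynomial.C (1 / 2 : ℝ) * (1 - Polynomial.X)) ^ (n - k)) +
        Polynomial.C (h (n + 1)) * Polynomial.X ^ (n + 2)) (m : ℕ) :
    ∑ k ∈ Finset.range (n + 1), f k * (2 * m + 1 : ℝ) ^ k = (2 * m + 3 : ℝ) ^ n +
      ∑ k ∈ Finset.range n,
        h (k + 1) * (4 * (m + 1 : ℝ) * (2 * m + 1) ^ k * (2 * m + 3) ^ (n - 1 - k)) +
      h (n + 1) * (2 * m + 1 : ℝ) ^ n := by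
  have heval : ∀ x : ℝ, (1 + x) * ∑ k ∈ Finset.range (n + 2), h k * x ^ k =
      1 + (∑ k ∈ Finset.range (n + 1), f k * x ^ (k + 1) * (1 / 2 * (1 - x)) ^ (n - k)) +
        h (n + 1) * x ^ (n + 2) := by
    intro x
    have := congrArg (Polynomial.eval x) hdef
    simpa [Polynomial.eval_finsetSum] using this
  have h0 : h 0 = 1 := by
    have := heval 0
    rw [Finset.sum_range_succ'] at this
    simpa using this
  set s : ℝ := 2 * m + 1 with hs
  set t : ℝ := 2 * m + 3 with ht
  have hs0 : s ≠ 0 := by positivity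
  have ht0 : t ≠ 0 := by positivity
  have hst : 4 * (m + 1 : ℝ) = s + t := by rw [hs, ht]; ring
  clear_value s t
  have e := heval (s / t)
  have hinv : 1 / 2 * (1 - s / t) = 1 / t := by
    field_simp
    rw [hs, ht]; ring
  have hU : t ^ (n + 1) * ∑ k ∈ Finset.range (n + 1), f k * (s / t) ^ (k + 1) * (1 / t) ^ (n - k) =
      s * ∑ k ∈ Finset.range (n + 1), f k * s ^ k := by
    rw [Finset.mul_sum, Finset.mul_sum]
    refine Finset.sum_congr rfl fun k hk => ?_
    obtain ⟨l, rfl⟩ := Nat.exists_eq_add_of_le (Nat.lt_succ_iff.1 (Finset.mem_range.1 hk))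
    rw [Nat.add_sub_cancel_left, div_pow, one_div_pow]
    field_simp
    ring
  have hT : t ^ n * ∑ k ∈ Finset.range n, h (k + 1) * (s / t) ^ (k + 1) =
      s * ∑ k ∈ Finset.range n, h (k + 1) * (s ^ k * t ^ (n - 1 - k)) := by
    rw [Finset.mul_sum, Finset.mul_sum]
    refine Finset.sum_congr rfl fun k hk => ?_
    obtain ⟨l, rfl⟩ := Nat.exists_eq_add_of_lt (Finset.mem_range.1 hk)
    rw [show k + l + 1 - 1 - k = l by omega, div_pow]
    field_simp
    ring
  have hsum : ∑ k ∈ Finset.range n, h (k + 1) * ((s + t) * s ^ k * t ^ (n - 1 - k)) =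
      (s + t) * ∑ k ∈ Finset.range n, h (k + 1) * (s ^ k * t ^ (n - 1 - k)) := by
    rw [Finset.mul_sum]
    exact Finset.sum_congr rfl fun k _ => by ring
  rw [hinv, Finset.sum_range_succ, Finset.sum_range_succ', h0] at e
  rw [hst, hsum]
  set S := ∑ k ∈ Finset.range n, h (k + 1) * (s / t) ^ (k + 1)
  set T := ∑ k ∈ Finset.range n, h (k + 1) * (s ^ k * t ^ (n - 1 - k))
  set V := ∑ k ∈ Finset.range (n + 1), f k * (s / t) ^ (k + 1) * (1 / t) ^ (n - k)
  set U := ∑ k ∈ Finset.range (n + 1), f k * s ^ k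
  apply mul_left_cancel₀ hs0
  obtain ⟨r, hr⟩ : ∃ r, r = s / t := ⟨_, rfl⟩
  have hrt : s = r * t := by rw [hr]; field_simp
  rw [← hr] at e
  have hp : s ^ n = r ^ n * t ^ n := by rw [hrt, mul_pow]
  rw [← hU, hp]
  have hT' : s * T = t ^ n * S := hT.symm
  calc t ^ (n + 1) * V = t ^ (n + 1) * ((1 + r) * (S + 1 * r ^ 0 + h (n + 1) * r ^ (n + 1)) - 1 -
        h (n + 1) * r ^ (n + 2)) := by rw [e]; ring
    _ = s * t ^ n + (s + t) * (s * T) + s * (h (n + 1) * (r ^ n * t ^ n)) := by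
        rw [hT', hrt]; ring
    _ = _ := by ring

theorem h_polynomial_eq (n : ℕ) (f h : ℕ → ℝ) (B g : ℕ → Polynomial ℝ)
    (hB : ∀ k, (B k : PowerSeries ℝ) =
      (1 - PowerSeries.X) ^ (k + 1) * PowerSeries.mk (fun m => ((2 * m + 1 : ℝ)) ^ k))
    (hg : ∀ k < n, (g k : PowerSeries ℝ) = (1 - PowerSeries.X) ^ (n + 1) * PowerSeries.mk
      (fun m => 4 * (m + 1 : ℝ) * (2 * m + 1) ^ k * (2 * m + 3) ^ (n - 1 - k)))
    (hdef : (1 + Polynomial.X) * ∑ k ∈ Finset.range (n + 2), Polynomial.C (h k) * Polynomial.X ^ k =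
      1 + (∑ k ∈ Finset.range (n + 1), Polynomial.C (f k) * Polynomial.X ^ (k + 1) *
            (Polynomial.C (1 / 2 : ℝ) * (1 - Polynomial.X)) ^ (n - k)) +
        Polynomial.C (h (n + 1)) * Polynomial.X ^ (n + 2)) :
    (1 - Polynomial.X) ^ (n + 1) + Polynomial.X * ∑ k ∈ Finset.range (n + 1),
        Polynomial.C (f k) * (1 - Polynomial.X) ^ (n - k) * B k =
      B n + Polynomial.X * ∑ k ∈ Finset.range n, Polynomial.C (h (k + 1)) * g k +
        Polynomial.C (h (n + 1)) * (Polynomial.X * B n) := by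
  apply Polynomial.coe_injective ℝ
  have hL : ((∑ k ∈ Finset.range (n + 1), Polynomial.C (f k) * (1 - Polynomial.X) ^ (n - k) * B k :
      Polynomial ℝ) : PowerSeries ℝ) = (1 - PowerSeries.X) ^ (n + 1) * PowerSeries.mk
        (fun m => ∑ k ∈ Finset.range (n + 1), f k * (2 * m + 1 : ℝ) ^ k) := by
    have : PowerSeries.mk (fun m : ℕ => ∑ k ∈ Finset.range (n + 1), f k * (2 * m + 1 : ℝ) ^ k) =
        ∑ k ∈ Finset.range (n + 1), PowerSeries.C (f k) *
          PowerSeries.mk (fun m => (2 * m + 1 : ℝ) ^ k) := by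
      ext m; simp
    rw [this, Finset.mul_sum, ← Polynomial.coeToPowerSeries.ringHom_apply, map_sum]
    refine Finset.sum_congr rfl fun k hk => ?_
    obtain ⟨l, rfl⟩ := Nat.exists_eq_add_of_le (Nat.lt_succ_iff.1 (Finset.mem_range.1 hk))
    rw [Polynomial.coeToPowerSeries.ringHom_apply, Nat.add_sub_cancel_left]
    push_cast
    rw [hB k]
    ring
  have hR : ((∑ k ∈ Finset.range n, Polynomial.C (h (k + 1)) * g k :
      Polynomial ℝ) : PowerSeries ℝ) = (1 - PowerSeries.X) ^ (n + 1) * PowerSeries.mk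
        (fun m => ∑ k ∈ Finset.range n,
          h (k + 1) * (4 * (m + 1 : ℝ) * (2 * m + 1) ^ k * (2 * m + 3) ^ (n - 1 - k))) := by
    have : PowerSeries.mk (fun m : ℕ => ∑ k ∈ Finset.range n,
          h (k + 1) * (4 * (m + 1 : ℝ) * (2 * m + 1) ^ k * (2 * m + 3) ^ (n - 1 - k))) =
        ∑ k ∈ Finset.range n, PowerSeries.C (h (k + 1)) * PowerSeries.mk
          (fun m => 4 * (m + 1 : ℝ) * (2 * m + 1) ^ k * (2 * m + 3) ^ (n - 1 - k)) := by
      ext m; simp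
    rw [this, Finset.mul_sum, ← Polynomial.coeToPowerSeries.ringHom_apply, map_sum]
    refine Finset.sum_congr rfl fun k hk => ?_
    rw [Polynomial.coeToPowerSeries.ringHom_apply, Polynomial.coe_mul, Polynomial.coe_C,
      hg k (Finset.mem_range.1 hk)]
    ring
  push_cast
  rw [hL, hR, hB n]
  have key : 1 + PowerSeries.X * PowerSeries.mk
        (fun m : ℕ => ∑ k ∈ Finset.range (n + 1), f k * (2 * m + 1 : ℝ) ^ k) =
      PowerSeries.mk (fun m : ℕ => (2 * m + 1 : ℝ) ^ n) + PowerSeries.X * PowerSeries.mk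
        (fun m : ℕ => ∑ k ∈ Finset.range n,
          h (k + 1) * (4 * (m + 1 : ℝ) * (2 * m + 1) ^ k * (2 * m + 3) ^ (n - 1 - k))) +
      PowerSeries.C (h (n + 1)) *
        (PowerSeries.X * PowerSeries.mk (fun m : ℕ => (2 * m + 1 : ℝ) ^ n)) := by
    ext m
    cases m with
    | zero => simp
    | succ m =>
      simp only [map_add, PowerSeries.coeff_succ_X_mul, PowerSeries.coeff_C_mul,
        PowerSeries.coeff_mk, PowerSeries.coeff_one, Nat.succ_ne_zero, if_false,
        sum_face_numbers_eq n f h hdef m]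
      push_cast
      ring
  linear_combination (1 - PowerSeries.X) ^ (n + 1) * key

/-- Corollary 3.6 (algebraic form): let `f_0, …, f_n` and `h_0, …, h_{n+1}` be real numbers
satisfying the defining equation of the normalized cubical `h`-vector,
`(1+x) ∑_{k=0}^{n+1} h_k x^k = 1 + ∑_{k=0}^n f_k x^{k+1} ((1-x)/2)^{n-k} + h_{n+1} x^{n+2}`,
with all `h_k` nonnegative.  Then the polynomial
`(1-x)^{n+1} + x ∑_{k=0}^n f_k (1-x)^{n-k} B_k(x)` (the `h`-polynomial of the barycentric
subdivision) is real-rooted and is interlaced by `B_n(x)`.  Here `B_k` is the type `B`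
Eulerian polynomial, determined by `∑_{m ≥ 0} (2m+1)^k x^m = B_k(x)/(1-x)^{k+1}` in `ℝ⟦x⟧`. -/
theorem sd_h_realRooted (n : ℕ) (f h : ℕ → ℝ) (B : ℕ → Polynomial ℝ)
    (hB : ∀ k, (B k : PowerSeries ℝ) =
      (1 - PowerSeries.X) ^ (k + 1) * PowerSeries.mk (fun m => ((2 * m + 1 : ℝ)) ^ k))
    (hdef : (1 + Polynomial.X) * ∑ k ∈ Finset.range (n + 2), Polynomial.C (h k) * Polynomial.X ^ k =
      1 + (∑ k ∈ Finset.range (n + 1), Polynomial.C (f k) * Polynomial.X ^ (k + 1) *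
            (Polynomial.C (1 / 2 : ℝ) * (1 - Polynomial.X)) ^ (n - k)) +
        Polynomial.C (h (n + 1)) * Polynomial.X ^ (n + 2))
    (hnonneg : ∀ k ≤ n + 1, 0 ≤ h k) :
    RealRooted ((1 - Polynomial.X) ^ (n + 1) +
        Polynomial.X * ∑ k ∈ Finset.range (n + 1),
          Polynomial.C (f k) * (1 - Polynomial.X) ^ (n - k) * B k) ∧
      Interlaces (B n)
        ((1 - Polynomial.X) ^ (n + 1) +
          Polynomial.X * ∑ k ∈ Finset.range (n + 1),
            Polynomial.C (f k) * (1 - Polynomial.X) ^ (n - k) * B k) := by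
  obtain ⟨a, ha, hneg, hBn, hg⟩ := exists_roots_eulerianB B hB n
  choose! g hgd hgc hgs using hg
  rw [h_polynomial_eq n f h B g hB hgc hdef, hBn]
  have hPd : (Lagrange.nodal (Finset.range n) a).natDegree = n := by
    rw [Lagrange.natDegree_nodal, Finset.card_range]
  have hsd : (Polynomial.X * ∑ k ∈ Finset.range n,
      Polynomial.C (h (k + 1)) * g k).natDegree ≤ n := by
    rcases Nat.eq_zero_or_pos n with rfl | hn
    · simp
    refine Polynomial.natDegree_mul_le.trans ?_
    have : (∑ k ∈ Finset.range n, Polynomial.C (h (k + 1)) * g k).natDegree ≤ n - 1 :=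
      Polynomial.natDegree_sum_le_of_forall_le _ _ fun k hk =>
        (Polynomial.natDegree_C_mul_le _ _).trans
          (Nat.le_sub_one_of_lt (hgd k (Finset.mem_range.1 hk)))
    rw [Polynomial.natDegree_X]
    omega
  have hXd : (Polynomial.C (h (n + 1)) *
      (Polynomial.X * Lagrange.nodal (Finset.range n) a)).natDegree ≤ n + 1 := by
    refine (Polynomial.natDegree_C_mul_le _ _).trans (Polynomial.natDegree_mul_le.trans ?_)
    rw [Polynomial.natDegree_X, hPd]
    omega
  have h0 : 0 < (Lagrange.nodal (Finset.range n) a + Polynomial.X *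
      ∑ k ∈ Finset.range n, Polynomial.C (h (k + 1)) * g k + Polynomial.C (h (n + 1)) *
        (Polynomial.X * Lagrange.nodal (Finset.range n) a)).eval 0 := by
    simp only [Polynomial.eval_add, Polynomial.eval_mul, Polynomial.eval_X, zero_mul, mul_zero,
      add_zero, Lagrange.eval_nodal]
    exact Finset.prod_pos fun i hi => by linarith [hneg i (Finset.mem_range.1 hi)]
  refine realRooted_and_interlaces_of_sign_alternates n a _ (fun i hi => ha i (i + 1) (by omega) hi)
    hneg (fun hz => ?_) ?_ ?_ h0.le fun i hi => ?_
  · rw [hz] at h0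
    simp at h0
  · exact Polynomial.natDegree_add_le_of_degree_le
      (Polynomial.natDegree_add_le_of_degree_le (by omega) (by omega)) hXd
  · have hlead : (Lagrange.nodal (Finset.range n) a).coeff n = 1 := by
      have hm := (Lagrange.nodal_monic (s := Finset.range n) (v := a)).coeff_natDegree
      rwa [hPd] at hm
    rw [Polynomial.coeff_add, Polynomial.coeff_add,
      Polynomial.coeff_eq_zero_of_natDegree_lt (by omega : _ < n + 1),
      Polynomial.coeff_eq_zero_of_natDegree_lt (by omega : _ < n + 1),
      Polynomial.coeff_C_mul, Polynomial.coeff_X_mul, hlead]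
    simpa using hnonneg (n + 1) le_rfl
  · have hPa : (Lagrange.nodal (Finset.range n) a).eval (a i) = 0 :=
      Lagrange.eval_nodal_at_node (v := a) (Finset.mem_range.2 hi)
    simp only [Polynomial.eval_add, Polynomial.eval_mul, Polynomial.eval_X, Polynomial.eval_C, hPa,
      Polynomial.eval_finsetSum, mul_zero, add_zero, zero_add]
    have : (-1 : ℝ) ^ (i + 1) * (a i * ∑ k ∈ Finset.range n, h (k + 1) * (g k).eval (a i)) =
        (-a i) * ∑ k ∈ Finset.range n, h (k + 1) * ((-1) ^ i * (g k).eval (a i)) := by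
      rw [Finset.mul_sum, Finset.mul_sum, Finset.mul_sum]
      exact Finset.sum_congr rfl fun k _ => by ring
    rw [this]
    have := hneg i hi
    exact mul_nonneg (by linarith) (Finset.sum_nonneg fun k hk => by
      have hk := Finset.mem_range.1 hk
      exact mul_nonneg (hnonneg (k + 1) (by omega)) (hgs k hk i hi))
end
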